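/- arXiv:0910.5313 — 5 statements merged into one kernel-verified Lean document; each statement's English description precedes it below -/
import Mathlib

section
/- Let ρ₁, ρ₂ be Borel measures on M that are finite on every ball, and for each open ball B let ν_B denote the finite signed measure (ρ₁ − ρ₂) restricted to B, with ⟨ν⟩_B = (ρ₁(B) − ρ₂(B))/μ(B). If there is K ≥ 0 such that |ν_B − ⟨ν⟩_B·μ|(B) ≤ K·μ(B) for every open ball B, then the total variation |ν| (the Borel measure whose restriction to each ball B is the total variation of ν_B) satisfies | |ν| − ⟨|ν|⟩_B·μ |(B) ≤ 2K·μ(B) for every open ball B. -/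
open MeasureTheory Metric

/-- The finite signed measure obtained by restricting the measure `ρ` to the set `B`
(defined when `ρ B < ∞`; junk value `0` otherwise). -/
noncomputable def restrictSM {M : Type*} [MeasurableSpace M]
    (ρ : MeasureTheory.Measure M) (B : Set M) : MeasureTheory.SignedMeasure M :=
  if h : ρ B < ⊤ then
    haveI : MeasureTheory.IsFiniteMeasure (ρ.restrict B) :=
      ⟨by simpa [MeasureTheory.Measure.restrict_apply_univ] using h⟩
    (ρ.restrict B).toSignedMeasure
  else 0

lemma restrictSM_apply_of_subset {M : Type*} [MeasurableSpace M] {ρ : Measure M} {B E : Set M}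
    (hρ : ρ B < ⊤) (hE : MeasurableSet E) (hEB : E ⊆ B) :
    restrictSM ρ B E = ρ.real E := by
  have : IsFiniteMeasure (ρ.restrict B) := ⟨by simpa using hρ⟩
  rw [restrictSM, dif_pos hρ, Measure.toSignedMeasure_apply_measurable hE,
    measureReal_restrict_apply hE, Set.inter_eq_left.2 hEB]

/-- Total variation is minimal among measures dominating a signed measure; here the dominating
measure is `|τ| + d • μ`. -/
lemma totalVariation_real_le_add {M : Type*} [MeasurableSpace M] {σ τ : SignedMeasure M}
    {μ : Measure M} {B : Set M} {d : ℝ} (hB : MeasurableSet B) (hμB : μ B < ⊤) (hd : 0 ≤ d)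
    (h : ∀ E, MeasurableSet E → E ⊆ B →
      |σ E| ≤ τ.totalVariation.real E + d * μ.real E) :
    σ.totalVariation.real B ≤ τ.totalVariation.real B + d * μ.real B := by
  have hreal : ∀ E ⊆ B, (τ.totalVariation + ENNReal.ofReal d • μ) E
      = ENNReal.ofReal (τ.totalVariation.real E + d * μ.real E) := fun E hE ↦ by
    have hfin : μ E ≠ ⊤ := ((measure_mono hE).trans_lt hμB).ne
    rw [ENNReal.ofReal_add (by positivity) (by positivity), ENNReal.ofReal_mul hd,
      ofReal_measureReal, ofReal_measureReal hfin]
    simp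
  have key : σ.totalVariation B ≤ (τ.totalVariation + ENNReal.ofReal d • μ) B := by
    rw [SignedMeasure.totalVariation_eq_variation]
    refine VectorMeasure.variation_apply_le_of_forall_enorm_le hB fun E hE hEB ↦ ?_
    rw [hreal E hEB, Real.enorm_eq_ofReal_abs]
    exact ENNReal.ofReal_le_ofReal (h E hE hEB)
  rw [hreal B subset_rfl] at key
  exact ENNReal.toReal_le_of_le_ofReal (by positivity) key

lemma abs_totalVariation_real_sub_le {M : Type*} [MeasurableSpace M] (σ : SignedMeasure M)
    {μ : Measure M} {B E : Set M} (c : ℝ) (hμB : μ B < ⊤) (hE : MeasurableSet E) (hEB : E ⊆ B) :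
    |σ.totalVariation.real E - |c| * μ.real E|
      ≤ (σ - c • restrictSM μ B).totalVariation.real E := by
  have hsub : ∀ F, MeasurableSet F → F ⊆ E →
      |σ F - c * μ.real F| ≤ (σ - c • restrictSM μ B).totalVariation.real F := fun F hF hFE ↦ by
    simpa [restrictSM_apply_of_subset hμB hF (hFE.trans hEB)] using
      (σ - c • restrictSM μ B).norm_le_totalVariation F
  have habs : ∀ F, |c * μ.real F| = |c| * μ.real F := fun F ↦ by
    rw [abs_mul, abs_of_nonneg measureReal_nonneg]
  have hupper := totalVariation_real_le_add (σ := σ) (τ := σ - c • restrictSM μ B) hE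
    ((measure_mono hEB).trans_lt hμB) (abs_nonneg c) fun F hF hFE ↦ by
      grind [abs_sub_abs_le_abs_sub (σ F) (c * μ.real F)]
  have hlower := abs_sub_abs_le_abs_sub (c * μ.real E) (σ E)
  rw [abs_sub_comm, habs] at hlower
  have hσ : |σ E| ≤ σ.totalVariation.real E := σ.norm_le_totalVariation E
  rw [abs_le]
  constructor <;> linarith [hsub E hE subset_rfl]

/-- The mean oscillation of `|σ|` is at most twice the distance of `σ` to any multiple of `μ`. -/
lemma totalVariation_oscillation_le {M : Type*} [MeasurableSpace M] (σ : SignedMeasure M)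
    {μ : Measure M} {B : Set M} (c : ℝ) (hB : MeasurableSet B) (hμ0 : 0 < μ B) (hμB : μ B < ⊤) :
    (restrictSM σ.totalVariation B
        - (σ.totalVariation.real B / μ.real B) • restrictSM μ B).totalVariation.real B
      ≤ 2 * (σ - c • restrictSM μ B).totalVariation.real B := by
  have hpos : 0 < μ.real B := ENNReal.toReal_pos hμ0.ne' hμB.ne
  set a := σ.totalVariation.real B / μ.real B
  have haB : a * μ.real B = σ.totalVariation.real B := div_mul_cancel₀ _ hpos.ne'
  have hmean : |(a - |c|)| * μ.real B ≤ (σ - c • restrictSM μ B).totalVariation.real B := by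
    have h := abs_totalVariation_real_sub_le σ c hμB hB subset_rfl
    rwa [← haB, ← sub_mul, abs_mul, abs_of_pos hpos] at h
  refine (totalVariation_real_le_add (τ := σ - c • restrictSM μ B) hB hμB
    (abs_nonneg (a - |c|)) fun E hE hEB ↦ ?_).trans (by linarith)
  have happly : (restrictSM σ.totalVariation B - a • restrictSM μ B) E
      = (σ.totalVariation.real E - |c| * μ.real E) - (a - |c|) * μ.real E := by
    simp only [sub_apply, smul_apply, smul_eq_mul,
      restrictSM_apply_of_subset hμB hE hEB,
      restrictSM_apply_of_subset (measure_lt_top σ.totalVariation B) hE hEB]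
    ring
  rw [happly]
  refine (abs_sub _ _).trans ?_
  rw [abs_mul (a - |c|), abs_of_nonneg (measureReal_nonneg (μ := μ) (s := E))]
  gcongr
  exact abs_totalVariation_real_sub_le σ c hμB hE hEB

/-- If the (ballwise-finite) signed measure `ν = ρ₁ − ρ₂` has bounded mean
oscillation with constant `K`, i.e. `|ν_B − ⟨ν⟩_B·μ|(B) ≤ K·μ(B)` for every open ball `B`,
then its total variation `|ν|` satisfies `| |ν| − ⟨|ν|⟩_B·μ |(B) ≤ 2K·μ(B)` for every ball. -/
theorem stmt1 {M : Type*} [MetricSpace M] [MeasurableSpace M] [BorelSpace M]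
    (μ ρ₁ ρ₂ : Measure M)
    (hμ : ∀ (x : M) (r : ℝ), 0 < r → 0 < μ (ball x r) ∧ μ (ball x r) < ⊤)
    (hρ₁ : ∀ (x : M) (r : ℝ), 0 < r → ρ₁ (ball x r) < ⊤)
    (hρ₂ : ∀ (x : M) (r : ℝ), 0 < r → ρ₂ (ball x r) < ⊤)
    (K : ℝ) (hK : 0 ≤ K)
    (hbmo : ∀ (x : M) (r : ℝ), 0 < r →
      ((restrictSM ρ₁ (ball x r) - restrictSM ρ₂ (ball x r))
          - (((ρ₁ (ball x r)).toReal - (ρ₂ (ball x r)).toReal) / (μ (ball x r)).toReal) •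
              restrictSM μ (ball x r)).totalVariation (ball x r)
        ≤ ENNReal.ofReal K * μ (ball x r)) :
    ∀ (x : M) (r : ℝ), 0 < r →
      (restrictSM ((restrictSM ρ₁ (ball x r) - restrictSM ρ₂ (ball x r)).totalVariation)
            (ball x r)
          - ((((restrictSM ρ₁ (ball x r) - restrictSM ρ₂ (ball x r)).totalVariation
                (ball x r)).toReal) / (μ (ball x r)).toReal) •
              restrictSM μ (ball x r)).totalVariation (ball x r)
        ≤ ENNReal.ofReal (2 * K) * μ (ball x r) := by
  intro x r hr
  obtain ⟨hμ0, hμB⟩ := hμ x r hr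
  have hosc := totalVariation_oscillation_le
    (restrictSM ρ₁ (ball x r) - restrictSM ρ₂ (ball x r))
    (((ρ₁ (ball x r)).toReal - (ρ₂ (ball x r)).toReal) / (μ (ball x r)).toReal)
    measurableSet_ball hμ0 hμB
  have hbound := ENNReal.toReal_mono (by finiteness) (hbmo x r hr)
  rw [ENNReal.toReal_mul, ENNReal.toReal_ofReal hK] at hbound
  simp only [measureReal_def] at hosc
  rw [← ENNReal.toReal_le_toReal (measure_ne_top _ _) (by finiteness), ENNReal.toReal_mul,
    ENNReal.toReal_ofReal (by positivity)]
  linarith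
end

section
/- Let ρ be a σ-finite Borel measure on M, finite on every ball, and suppose there is K ≥ 0 such that for every open ball B the finite signed measure (ρ − ⟨ρ⟩_B·μ) restricted to B has total variation at most K·μ(B), where ⟨ρ⟩_B = ρ(B)/μ(B). Let ρ = ρ_a + ρ_s be the Lebesgue decomposition of ρ with respect to μ, where ρ_a ≪ μ and ρ_s ⊥ μ. Then ρ_s(B) ≤ K·μ(B) for every open ball B. -/
open MeasureTheory Metric

theorem restrictSM_apply {M : Type*} [MeasurableSpace M] (ρ : Measure M) {A B : Set M}
    (hB : ρ B < ⊤) (hA : MeasurableSet A) (hAB : A ⊆ B) :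
    restrictSM ρ B A = ρ.real A := by
  have : IsFiniteMeasure (ρ.restrict B) := isFiniteMeasure_restrict.mpr hB.ne
  rw [restrictSM, dif_pos hB, Measure.toSignedMeasure_apply_measurable hA,
    measureReal_restrict_apply hA, Set.inter_eq_left.mpr hAB]

/-- If a σ-finite Borel measure `ρ`, finite on balls, has bounded mean
oscillation with constant `K` (i.e. `|ρ − ⟨ρ⟩_B·μ|(B) ≤ K·μ(B)` for every open ball `B`),
and `ρ = ρa + ρs` is its Lebesgue decomposition with respect to `μ` (`ρa ≪ μ`, `ρs ⊥ μ`),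
then `ρs(B) ≤ K·μ(B)` for every open ball `B`. -/
theorem stmt2 {M : Type*} [MetricSpace M] [MeasurableSpace M] [BorelSpace M]
    (μ ρ : Measure M) [SigmaFinite μ] [SigmaFinite ρ]
    (hμ : ∀ (x : M) (r : ℝ), 0 < r → 0 < μ (ball x r) ∧ μ (ball x r) < ⊤)
    (hρ : ∀ (x : M) (r : ℝ), 0 < r → ρ (ball x r) < ⊤)
    (K : ℝ) (hK : 0 ≤ K)
    (hbmo : ∀ (x : M) (r : ℝ), 0 < r →
      (restrictSM ρ (ball x r)
          - ((ρ (ball x r)).toReal / (μ (ball x r)).toReal) •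
              restrictSM μ (ball x r)).totalVariation (ball x r)
        ≤ ENNReal.ofReal K * μ (ball x r))
    (ρa ρs : Measure M) (hdecomp : ρ = ρa + ρs)
    (hac : ρa ≪ μ) (hsing : MeasureTheory.Measure.MutuallySingular ρs μ) :
    ∀ (x : M) (r : ℝ), 0 < r → ρs (ball x r) ≤ ENNReal.ofReal K * μ (ball x r) := by
  intro x r hr
  obtain ⟨s, hs, hρs, hμs⟩ := hsing
  set B := ball x r
  have hA : MeasurableSet (B ∩ sᶜ) := measurableSet_ball.inter hs.compl
  have hAB : B ∩ sᶜ ⊆ B := Set.inter_subset_left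
  have hμA : μ (B ∩ sᶜ) = 0 := measure_mono_null Set.inter_subset_right hμs
  have hle : ρs ≤ ρ := hdecomp ▸ Measure.le_add_left le_rfl
  calc ρs B ≤ ρs (B ∩ s) + ρs (B ∩ sᶜ) := (measure_inter_add_sdiff B hs).ge
    _ = ρs (B ∩ sᶜ) := by rw [measure_mono_null Set.inter_subset_right hρs, zero_add]
    _ ≤ ρ (B ∩ sᶜ) := hle _
    _ = ‖(restrictSM ρ B
          - ((ρ B).toReal / (μ B).toReal) • restrictSM μ B) (B ∩ sᶜ)‖ₑ := by
        rw [sub_apply, smul_apply,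
          restrictSM_apply ρ (hρ x r hr) hA hAB, restrictSM_apply μ (hμ x r hr).2 hA hAB,
          measureReal_def μ, hμA, ENNReal.toReal_zero, smul_zero, sub_zero,
          Real.enorm_of_nonneg measureReal_nonneg,
          ofReal_measureReal (measure_mono hAB |>.trans_lt (hρ x r hr)).ne]
    _ ≤ _ := SignedMeasure.enorm_le_totalVariation _ _
    _ ≤ _ := measure_mono hAB
    _ ≤ ENNReal.ofReal K * μ B := hbmo x r hr
end

section
/- Let M be a locally compact metric space and μ a Borel measure on M with 0 < μ(B) < ∞ for every open ball B of positive radius. Let f : M → ℝ be locally μ-integrable and suppose that ∫_M f·φ dμ = 0 for every continuous compactly supported function φ : M → ℝ with ∫_M φ dμ = 0. Then there is a constant c ∈ ℝ such that f = c μ-almost everywhere. -/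
open MeasureTheory Metric

open Set Filter Topology

/-- A metric space carrying a measure which is positive and finite on all balls is second
countable. -/
theorem secondCountableTopology_of_measure_ball_pos_lt_top {X : Type*} [MetricSpace X]
    [MeasurableSpace X] [OpensMeasurableSpace X] {μ : Measure X}
    (hμ : ∀ (x : X) (r : ℝ), 0 < r → 0 < μ (ball x r) ∧ μ (ball x r) < ⊤) :
    SecondCountableTopology X := by
  rcases isEmpty_or_nonempty X with hX | ⟨⟨x₀⟩⟩
  · infer_instance
  have : SigmaFinite μ := ⟨⟨{
    set := fun n ↦ ball x₀ (n + 1)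
    set_mem := fun _ ↦ mem_univ _
    finite := fun n ↦ (hμ x₀ _ n.cast_add_one_pos).2
    spanning := eq_univ_of_forall fun x ↦ by
      obtain ⟨n, hn⟩ := exists_nat_gt (dist x x₀)
      exact mem_iUnion.2 ⟨n, mem_ball.2 (by linarith)⟩ }⟩⟩
  refine Metric.secondCountable_of_almost_dense_set fun ε hε ↦ ?_
  obtain ⟨u, -, hdisj, hcov⟩ := Vitali.exists_disjoint_subfamily_covering_enlargement_closedBall
    (univ : Set X) id (fun _ ↦ ε / 5) (ε / 5) (fun _ _ ↦ le_rfl) 5 (by norm_num)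
  have hpos (x : X) : 0 < μ (closedBall x (ε / 5)) :=
    (hμ x _ (by positivity)).1.trans_le (measure_mono ball_subset_closedBall)
  refine ⟨u, ?_, fun x ↦ ?_⟩
  · have := Measure.countable_meas_pos_of_disjoint_iUnion (μ := μ)
      (As := fun x : u ↦ closedBall (x : X) (ε / 5)) (fun _ ↦ measurableSet_closedBall)
      (fun x y hxy ↦ hdisj x.2 y.2 (Subtype.coe_ne_coe.2 hxy))
    simpa [hpos, countable_univ_iff, countable_coe_iff] using this
  · obtain ⟨y, hy, hxy⟩ := hcov x (mem_univ x)
    have := hxy (mem_closedBall_self (by positivity))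
    simp only [mem_closedBall, id] at this
    exact ⟨y, hy, this.trans_eq (by ring)⟩

/-- If a locally integrable function on a locally compact, σ-compact metric space has zero integral
against every continuous compactly supported function, then it vanishes almost everywhere. -/
theorem ae_eq_zero_of_integral_continuous_smul_eq_zero {X E : Type*} [MetricSpace X]
    [LocallyCompactSpace X] [SigmaCompactSpace X] [MeasurableSpace X] [BorelSpace X]
    [NormedAddCommGroup E] [NormedSpace ℝ E] [CompleteSpace E] {μ : Measure X} {f : X → E}
    (hf : LocallyIntegrable f μ)
    (h : ∀ g : X → ℝ, Continuous g → HasCompactSupport g → ∫ x, g x • f x ∂μ = 0) :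
    f =ᵐ[μ] 0 := by
  refine ae_eq_zero_of_forall_setIntegral_isCompact_eq_zero' hf fun s hs ↦ ?_
  obtain ⟨δ, δpos, hδ⟩ := hs.exists_isCompact_cthickening
  obtain ⟨u, -, u_mem, u_lim⟩ : ∃ u : ℕ → ℝ, StrictAnti u ∧ (∀ n, u n ∈ Ioo 0 δ) ∧
    Tendsto u atTop (𝓝 0) := exists_seq_strictAnti_tendsto' δpos
  have u_pos n : 0 < u n := (u_mem n).1
  let g (n : ℕ) (x : X) : ℝ := thickenedIndicator (u_pos n) s x
  have g_cont n : Continuous (g n) :=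
    NNReal.continuous_coe.comp (thickenedIndicator (u_pos n) s).continuous
  have g_zero n x (hx : x ∉ cthickening δ s) : g n x = 0 := by
    have : x ∉ thickening (u n) s :=
      fun h ↦ hx (thickening_subset_cthickening_of_le (u_mem n).2.le s h)
    exact NNReal.coe_eq_zero.2 (thickenedIndicator_zero (u_pos n) s this)
  have key : Tendsto (fun n ↦ ∫ x, g n x • f x ∂μ) atTop (𝓝 (∫ x in s, f x ∂μ)) := by
    rw [← integral_indicator hs.measurableSet]
    refine tendsto_integral_of_dominated_convergence ((cthickening δ s).indicator fun x ↦ ‖f x‖)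
      (fun n ↦ (g_cont n).aestronglyMeasurable.smul hf.aestronglyMeasurable) ?_ (fun n ↦ ?_) ?_
    · rw [integrable_indicator_iff hδ.measurableSet]
      exact (hf.integrableOn_isCompact hδ).norm
    · refine .of_forall fun x ↦ le_indicator_apply (fun _ ↦ ?_) (fun hx ↦ by simp [g_zero n x hx])
      rw [norm_smul]
      refine mul_le_of_le_one_left (norm_nonneg _) ?_
      simpa [g] using thickenedIndicator_le_one (u_pos n) s x
    · refine .of_forall fun x ↦ ?_
      have hlim := tendsto_pi_nhds.1 (thickenedIndicator_tendsto_indicator_closure u_pos u_lim s) x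
      rw [hs.isClosed.closure_eq] at hlim
      have hsmul := ((NNReal.continuous_coe.tendsto _).comp hlim).smul_const (f x)
      have hind : s.indicator f x = ((s.indicator (fun _ ↦ 1) x : NNReal) : ℝ) • f x := by
        by_cases hx : x ∈ s <;> simp [hx]
      rwa [hind]
  refine tendsto_nhds_unique key (tendsto_const_nhds.congr fun n ↦ ?_)
  exact (h _ (g_cont n) (.intro hδ (g_zero n))).symm

/-- On a locally compact metric space with a Borel measure `μ` positive and
finite on balls, a locally integrable function `f` orthogonal to all continuous compactly
supported functions of mean zero is a.e. constant. -/
theorem stmt6 {M : Type*} [MetricSpace M] [MeasurableSpace M] [BorelSpace M]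
    [LocallyCompactSpace M]
    (μ : Measure M)
    (hμ : ∀ (x : M) (r : ℝ), 0 < r → 0 < μ (ball x r) ∧ μ (ball x r) < ⊤)
    (f : M → ℝ) (hf : MeasureTheory.LocallyIntegrable f μ)
    (horth : ∀ φ : M → ℝ, Continuous φ → HasCompactSupport φ →
      (∫ x, φ x ∂μ) = 0 → (∫ x, f x * φ x ∂μ) = 0) :
    ∃ c : ℝ, f =ᵐ[μ] fun _ => c := by
  rcases isEmpty_or_nonempty M with hM | ⟨⟨x₀⟩⟩
  · exact ⟨0, .of_forall fun x ↦ isEmptyElim x⟩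
  have : SecondCountableTopology M := secondCountableTopology_of_measure_ball_pos_lt_top hμ
  have : IsLocallyFiniteMeasure μ :=
    ⟨fun x ↦ ⟨ball x 1, ball_mem_nhds x one_pos, (hμ x 1 one_pos).2⟩⟩
  have : μ.IsOpenPosMeasure := ⟨fun U hU ⟨x, hx⟩ ↦ by
    obtain ⟨r, hr, hrU⟩ := Metric.isOpen_iff.1 hU x hx
    exact ((hμ x r hr).1.trans_le (measure_mono hrU)).ne'⟩
  obtain ⟨ψ, hψ_one, -, hψ_supp, hψ_mem⟩ := exists_continuous_one_zero_of_isCompact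
    (isCompact_singleton (x := x₀)) isClosed_empty (disjoint_empty _)
  have hψ_pos : 0 < ∫ x, ψ x ∂μ :=
    ψ.continuous.integral_pos_of_hasCompactSupport_nonneg_nonzero hψ_supp (fun x ↦ (hψ_mem x).1)
      (x := x₀) (by simp [hψ_one (mem_singleton x₀)])
  have hint (φ : M → ℝ) (hφ : Continuous φ) (hφ' : HasCompactSupport φ) :
      Integrable (fun x ↦ f x * φ x) μ := by
    simpa [mul_comm] using hf.integrable_smul_left_of_hasCompactSupport hφ hφ'
  set c : ℝ := (∫ x, f x * ψ x ∂μ) / ∫ x, ψ x ∂μ with hc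
  refine ⟨c, ?_⟩
  have hzero : (fun x ↦ f x - c) =ᵐ[μ] 0 := by
    refine ae_eq_zero_of_integral_continuous_smul_eq_zero (hf.sub (locallyIntegrable_const c))
      fun φ hφ hφ' ↦ ?_
    have hφi : Integrable φ μ := hφ.integrable_of_hasCompactSupport hφ'
    have hψi : Integrable ψ μ := ψ.continuous.integrable_of_hasCompactSupport hψ_supp
    set a : ℝ := (∫ x, φ x ∂μ) / ∫ x, ψ x ∂μ with ha
    have hmean : ∫ x, (φ x - a * ψ x) ∂μ = 0 := by
      rw [integral_sub hφi (hψi.const_mul a), integral_const_mul, ha]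
      field_simp
      ring
    have horth' := horth (fun x ↦ φ x - a * ψ x) (by fun_prop) (hφ'.sub hψ_supp.mul_left) hmean
    have hsplit : ∫ x, f x * (φ x - a * ψ x) ∂μ =
        (∫ x, f x * φ x ∂μ) - a * ∫ x, f x * ψ x ∂μ := by
      rw [← integral_const_mul, ← integral_sub (hint φ hφ hφ')
        ((hint ψ ψ.continuous hψ_supp).const_mul a)]
      exact integral_congr_ae (.of_forall fun x ↦ by ring)
    calc ∫ x, φ x • (f x - c) ∂μ = ∫ x, (f x * φ x - c * φ x) ∂μ :=
          integral_congr_ae (.of_forall fun x ↦ by simp only [smul_eq_mul]; ring)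
      _ = (∫ x, f x * φ x ∂μ) - c * ∫ x, φ x ∂μ := by
          rw [integral_sub (hint φ hφ hφ') (hφi.const_mul c), integral_const_mul]
      _ = (∫ x, f x * φ x ∂μ) - a * ∫ x, f x * ψ x ∂μ := by rw [hc, ha]; ring
      _ = 0 := hsplit.symm.trans horth'
  filter_upwards [hzero] with x hx using sub_eq_zero.1 hx
end

section
/- Let M be locally compact and μ doubling with μ(M) = ∞. Let V denote the vector space of continuous compactly supported functions φ : M → ℝ with ∫_M φ dμ = 0, and let λ : V → ℝ be a linear functional such that |λ(a)| ≤ K for every continuous compactly supported (1,∞)-atom a. Then there exists a locally μ-integrable function f : M → ℝ with ‖f‖_{BMO} ≤ 2K such that λ(φ) = ∫_M f·φ dμ for every φ ∈ V. -/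
open MeasureTheory Metric

/-- A `(1,∞)`-atom: a bounded measurable function supported in some open ball `B` with
`‖a‖_∞ ≤ μ(B)⁻¹` and mean zero. -/
def IsOneInfAtom {M : Type*} [MetricSpace M] [MeasurableSpace M]
    (μ : MeasureTheory.Measure M) (a : M → ℝ) : Prop :=
  Measurable a ∧ ∃ (x : M) (r : ℝ), 0 < r ∧ (∀ y, y ∉ ball x r → a y = 0) ∧
    (∀ᵐ y ∂μ, |a y| ≤ ((μ (ball x r)).toReal)⁻¹) ∧ (∫ y, a y ∂μ) = 0

/-- Membership in `V`: continuous, compactly supported, mean zero. -/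
def MemV {M : Type*} [MetricSpace M] [MeasurableSpace M]
    (μ : MeasureTheory.Measure M) (φ : M → ℝ) : Prop :=
  Continuous φ ∧ HasCompactSupport φ ∧ (∫ x, φ x ∂μ) = 0

open scoped CompactlySupported NNReal ENNReal Pointwise

theorem secondCountableTopology_of_measure_ball {M : Type*} [MetricSpace M] [MeasurableSpace M]
    [BorelSpace M] (μ : Measure M)
    (hμ : ∀ (x : M) (r : ℝ), 0 < r → 0 < μ (ball x r) ∧ μ (ball x r) < ⊤) :
    SecondCountableTopology M := by
  rcases isEmpty_or_nonempty M with hM | ⟨⟨x₀⟩⟩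
  · infer_instance
  have hσ : SigmaFinite μ := by
    refine ⟨⟨⟨fun n : ℕ => ball x₀ (n + 1), fun _ => trivial,
      fun n => (hμ x₀ (n + 1) (by positivity)).2, ?_⟩⟩⟩
    refine Set.eq_univ_of_forall fun y => Set.mem_iUnion.2 ?_
    obtain ⟨n, hn⟩ := exists_nat_gt (dist y x₀)
    exact ⟨n, by rw [mem_ball]; linarith⟩
  refine secondCountable_of_almost_dense_set fun ε hε => ?_
  obtain ⟨u, -, hdisj, hcov⟩ := Vitali.exists_disjoint_subfamily_covering_enlargement_closedBall
    (Set.univ : Set M) id (fun _ => ε / 5) (ε / 5) (fun _ _ => le_rfl) 5 (by norm_num)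
  refine ⟨u, ?_, fun x => ?_⟩
  · have := Measure.countable_meas_pos_of_disjoint_iUnion (μ := μ)
      (As := fun i : u => ball (i : M) (ε / 5)) (fun i => measurableSet_ball) (by
        intro i j hij
        exact (hdisj i.2 j.2 (fun h => hij (Subtype.ext h))).mono
          ball_subset_closedBall ball_subset_closedBall)
    have huniv : {i : u | 0 < μ (ball (i : M) (ε / 5))} = Set.univ :=
      Set.eq_univ_of_forall fun i => (hμ i (ε / 5) (by positivity)).1
    rw [huniv] at this
    exact Set.countable_coe_iff.1 (Set.countable_univ_iff.1 this)
  · obtain ⟨b, hb, hsub⟩ := hcov x trivial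
    refine ⟨b, hb, ?_⟩
    have := hsub (mem_closedBall_self (by positivity : (0 : ℝ) ≤ ε / 5))
    simp only [id, mem_closedBall] at this
    linarith

theorem isLUB_image_Icc_unique {X : Type*} [TopologicalSpace X] (L : C_c(X, ℝ) →ₗ[ℝ] ℝ)
    {f : C_c(X, ℝ)} {s t : ℝ} (hs : IsLUB (L '' Set.Icc 0 f) s)
    (ht : IsLUB ((-L) '' Set.Icc 0 f) t) : L f = s - t := by
  have hmem : ∀ g ∈ Set.Icc 0 f, f - g ∈ Set.Icc 0 f := fun g hg =>
    ⟨sub_nonneg.2 hg.2, sub_le_self _ hg.1⟩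
  have h1 : t ≤ s - L f := ht.2 <| by
    rintro _ ⟨g, hg, rfl⟩
    have := hs.1 ⟨f - g, hmem g hg, rfl⟩
    simp only [map_sub, LinearMap.neg_apply] at this ⊢
    linarith
  have h2 : s ≤ t + L f := hs.2 <| by
    rintro _ ⟨g, hg, rfl⟩
    have := ht.1 ⟨f - g, hmem g hg, rfl⟩
    simp only [map_sub, LinearMap.neg_apply] at this ⊢
    linarith
  linarith

theorem exists_regular_isLUB_integral {X : Type*} [TopologicalSpace X] [T2Space X]
    [LocallyCompactSpace X] [MeasurableSpace X] [BorelSpace X] (L : C_c(X, ℝ) →ₗ[ℝ] ℝ)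
    (hL : ∀ f, 0 ≤ f → BddAbove (L '' Set.Icc 0 f)) :
    ∃ ν : Measure X, ν.Regular ∧ ∀ f : C_c(X, ℝ), 0 ≤ f →
      IsLUB (L '' Set.Icc 0 f) (∫ x, f x ∂ν) := by
  have hne : ∀ f : C_c(X, ℝ), 0 ≤ f → (L '' Set.Icc 0 f).Nonempty := fun f hf =>
    ⟨L 0, 0, ⟨le_rfl, hf⟩, rfl⟩
  have hlub : ∀ f : C_c(X, ℝ), 0 ≤ f → IsLUB (L '' Set.Icc 0 f) (sSup (L '' Set.Icc 0 f)) :=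
    fun f hf => isLUB_csSup (hne f hf) (hL f hf)
  have hnonneg : ∀ f : C_c(X, ℝ), 0 ≤ f → 0 ≤ sSup (L '' Set.Icc 0 f) := fun f hf =>
    (hlub f hf).1 ⟨0, ⟨le_rfl, hf⟩, map_zero L⟩
  have hadd : ∀ f g : C_c(X, ℝ), 0 ≤ f → 0 ≤ g → sSup (L '' Set.Icc 0 (f + g)) =
      sSup (L '' Set.Icc 0 f) + sSup (L '' Set.Icc 0 g) := by
    intro f g hf hg
    rw [← csSup_add (hne f hf) (hL f hf) (hne g hg) (hL g hg), ← Set.image_add]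
    congr 2
    ext h
    rw [Set.mem_add]
    constructor
    · rintro ⟨h0, h1⟩
      refine ⟨h ⊓ f, ⟨le_inf h0 hf, inf_le_right⟩, h - h ⊓ f,
        ⟨sub_nonneg.2 inf_le_left, ?_⟩, by abel⟩
      intro x
      have h1x := h1 x
      have hgx := hg x
      simp only [CompactlySupportedContinuousMap.coe_add, Pi.add_apply] at h1x
      change h x - min (h x) (f x) ≤ g x
      change 0 ≤ g x at hgx
      change h x ≤ f x + g x at h1x
      rcases min_choice (h x) (f x) with hm | hm <;> rw [hm] <;> linarith
    · rintro ⟨a, ha, b, hb, rfl⟩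
      exact ⟨add_nonneg ha.1 hb.1, add_le_add ha.2 hb.2⟩
  have hsmul : ∀ (c : ℝ≥0) (f : C_c(X, ℝ)), 0 ≤ f → sSup (L '' Set.Icc 0 (c • f)) =
      c * sSup (L '' Set.Icc 0 f) := by
    intro c f hf
    rcases eq_or_ne c 0 with rfl | hc
    · simp
    have hc' : (0 : ℝ) < c := by positivity
    rw [← smul_eq_mul, ← Real.sSup_smul_of_nonneg hc'.le]
    congr 1
    ext t
    rw [Set.mem_smul_set]
    constructor
    · rintro ⟨g, ⟨h0, h1⟩, rfl⟩
      refine ⟨_, ⟨(c : ℝ)⁻¹ • g, ⟨fun x => ?_, fun x => ?_⟩, rfl⟩, ?_⟩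
      · have := h0 x
        change 0 ≤ g x at this
        change 0 ≤ (c : ℝ)⁻¹ * g x
        positivity
      · have := h1 x
        change g x ≤ c * f x at this
        change (c : ℝ)⁻¹ * g x ≤ f x
        rwa [inv_mul_le_iff₀ hc']
      · rw [map_smul, smul_smul, mul_inv_cancel₀ hc'.ne', one_smul]
    · rintro ⟨_, ⟨g, ⟨h0, h1⟩, rfl⟩, rfl⟩
      refine ⟨(c : ℝ) • g, ⟨fun x => ?_, fun x => ?_⟩, map_smul _ _ _⟩
      · have := h0 x
        change 0 ≤ g x at this
        change 0 ≤ (c : ℝ) * g x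
        positivity
      · have := h1 x
        change g x ≤ f x at this
        change (c : ℝ) * g x ≤ c * f x
        gcongr
  let P : C_c(X, ℝ≥0) →ₗ[ℝ≥0] ℝ≥0 :=
    { toFun := fun f => ⟨sSup (L '' Set.Icc 0 f.toReal), hnonneg _ f.toReal_nonneg⟩
      map_add' := fun f g => NNReal.eq <| by
        change sSup (L '' Set.Icc 0 (f + g).toReal) = _ + _
        rw [CompactlySupportedContinuousMap.toReal_add]
        exact hadd f.toReal g.toReal f.toReal_nonneg g.toReal_nonneg
      map_smul' := fun c f => NNReal.eq <| by
        change sSup (L '' Set.Icc 0 (c • f).toReal) = c * _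
        rw [CompactlySupportedContinuousMap.toReal_smul]
        exact hsmul c f.toReal f.toReal_nonneg }
  refine ⟨NNRealRMK.rieszMeasure P, inferInstance, fun f hf => ?_⟩
  have hf' : f.nnrealPart.toReal = f := by
    ext x
    simpa using hf x
  have := NNRealRMK.integral_rieszMeasure P f.nnrealPart
  have h2 : ∀ x, ((f.nnrealPart x : ℝ≥0) : ℝ) = f x := fun x => by
    simpa using DFunLike.congr_fun hf' x
  simp only [h2] at this
  rw [this]
  change IsLUB _ (sSup (L '' Set.Icc 0 f.nnrealPart.toReal))
  rw [hf']
  exact hlub f hf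

theorem absolutelyContinuous_of_measure_inter_ball_le {M : Type*} [MetricSpace M]
    [MeasurableSpace M] [BorelSpace M] [SecondCountableTopology M] (μ ν : Measure M)
    [μ.OuterRegular] {D C : ℝ≥0∞} (hD : D ≠ ⊤) (hC : C ≠ ⊤)
    (hdoub : ∀ (x : M) (r : ℝ), 0 < r → μ (ball x (2 * r)) ≤ D * μ (ball x r))
    (hν : ∀ E, μ E = 0 → ∀ (x : M) (r : ℝ), 0 < r → ν (E ∩ ball x r) ≤ C * μ (ball x r)) :
    ν ≪ μ := by
  intro E hE
  have hdoub8 : ∀ (x : M) (r : ℝ), 0 < r → μ (ball x (8 * r)) ≤ D ^ 3 * μ (ball x r) := by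
    intro x r hr
    calc μ (ball x (8 * r)) = μ (ball x (2 * (2 * (2 * r)))) := by ring_nf
      _ ≤ D * (D * (D * μ (ball x r))) :=
        (hdoub _ _ (by positivity)).trans <| mul_le_mul_right ((hdoub _ _ (by positivity)).trans <|
          mul_le_mul_right (hdoub _ _ hr) _) _
      _ = D ^ 3 * μ (ball x r) := by ring
  suffices h : ∀ ε : ℝ≥0∞, 0 < ε → ν E ≤ C * D ^ 3 * ε by
    have hfin : C * D ^ 3 ≠ ⊤ := ENNReal.mul_ne_top hC (ENNReal.pow_ne_top hD)
    refine le_antisymm (ENNReal.le_of_forall_pos_le_add fun ε hε _ => ?_) zero_le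
    refine (h (ε / (C * D ^ 3)) (ENNReal.div_pos (by simpa using hε.ne') hfin)).trans ?_
    rw [zero_add]
    exact ENNReal.mul_div_le
  intro ε hε
  obtain ⟨U, hEU, hUo, hUε⟩ := E.exists_isOpen_lt_of_lt (μ := μ) ε (by rwa [hE])
  have hr : ∀ x : M, ∃ r : ℝ, 0 < r ∧ r ≤ 1 ∧ (x ∈ E → closedBall x r ⊆ U) := by
    intro x
    by_cases hx : x ∈ E
    · obtain ⟨r, hr, hrU⟩ := Metric.nhds_basis_closedBall.mem_iff.1 (hUo.mem_nhds (hEU hx))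
      exact ⟨min r 1, by positivity, min_le_right _ _, fun _ =>
        (closedBall_subset_closedBall (min_le_left _ _)).trans hrU⟩
    · exact ⟨1, one_pos, le_rfl, fun h => absurd h hx⟩
  choose r hr0 hr1 hrU using hr
  obtain ⟨u, huE, hdisj, hcov⟩ := Vitali.exists_disjoint_subfamily_covering_enlargement_closedBall
    E id r 1 (fun a _ => hr1 a) 5 (by norm_num)
  have hdisj' : u.PairwiseDisjoint fun a => ball a (r a) := fun a ha b hb hab =>
    (hdisj ha hb hab).mono ball_subset_closedBall ball_subset_closedBall
  have hu : u.Countable := hdisj'.countable_of_isOpen (fun _ _ => isOpen_ball)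
    (fun a _ => nonempty_ball.2 (hr0 a))
  have : Countable u := hu.to_subtype
  calc ν E ≤ ν (⋃ b ∈ u, E ∩ ball b (8 * r b)) := by
        refine measure_mono fun x hx => ?_
        obtain ⟨b, hb, hsub⟩ := hcov x hx
        refine Set.mem_biUnion hb ⟨hx, ?_⟩
        have := hsub (mem_closedBall_self (hr0 x).le)
        simp only [id, mem_closedBall] at this
        rw [mem_ball]
        linarith [hr0 b]
    _ ≤ ∑' b : u, ν (E ∩ ball (b : M) (8 * r b)) := measure_biUnion_le _ hu _
    _ ≤ ∑' b : u, C * D ^ 3 * μ (ball (b : M) (r b)) := by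
        refine ENNReal.tsum_le_tsum fun b => ?_
        refine (hν E hE _ _ (by linarith [hr0 b])).trans ?_
        rw [mul_assoc]
        exact mul_le_mul_right (hdoub8 _ _ (hr0 b)) _
    _ = C * D ^ 3 * μ (⋃ b ∈ u, ball b (r b)) := by
        rw [ENNReal.tsum_mul_left, measure_biUnion hu hdisj' fun _ _ => measurableSet_ball]
    _ ≤ C * D ^ 3 * ε := by
        refine mul_le_mul_right ((measure_mono ?_).trans hUε.le) _
        exact Set.iUnion₂_subset fun b hb => ball_subset_closedBall.trans (hrU b (huE hb))

theorem exists_bump_ball {M : Type*} [MetricSpace M] [LocallyCompactSpace M]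
    [MeasurableSpace M] [BorelSpace M] (μ : Measure M) [IsLocallyFiniteMeasure μ]
    [μ.IsOpenPosMeasure] (x : M) {r : ℝ} (hr : 0 < r) :
    ∃ θ : C_c(M, ℝ), (∀ y ∉ ball x r, θ y = 0) ∧ (∀ y, 0 ≤ θ y) ∧ (∀ y, θ y ≤ 1) ∧
      0 < ∫ y, θ y ∂μ := by
  obtain ⟨θ, h1, hc, hs, h01⟩ := exists_continuousMap_one_of_isCompact_subset_isOpen
    (isCompact_singleton (x := x)) (isOpen_ball (x := x) (ε := r)) (by simpa using hr)
  refine ⟨⟨θ, hc⟩, fun y hy => image_eq_zero_of_notMem_tsupport fun h => hy (hs h),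
    fun y => (h01 y).1, fun y => (h01 y).2, ?_⟩
  refine θ.continuous.integral_pos_of_hasCompactSupport_nonneg_nonzero hc
    (fun y => (h01 y).1) (x := x) ?_
  have h1x : θ x = 1 := h1 (Set.mem_singleton x)
  exact h1x.trans_ne one_ne_zero

/-- `Λ` is bounded by `K` on continuous compactly supported multiples of `(1,∞)`-atoms. -/
def AtomBounded {M : Type*} [MetricSpace M] [MeasurableSpace M] (μ : Measure M) (K : ℝ)
    (Λ : C_c(M, ℝ) →ₗ[ℝ] ℝ) : Prop :=
  ∀ φ : C_c(M, ℝ), (∫ y, φ y ∂μ) = 0 → ∀ (x : M) (r C : ℝ), 0 < r → 0 ≤ C →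
    (∀ y ∉ ball x r, φ y = 0) → (∀ y, |φ y| ≤ C) → |Λ φ| ≤ K * C * (μ (ball x r)).toReal

theorem AtomBounded.neg {M : Type*} [MetricSpace M] [MeasurableSpace M] {μ : Measure M} {K : ℝ}
    {Λ : C_c(M, ℝ) →ₗ[ℝ] ℝ} (h : AtomBounded μ K Λ) : AtomBounded μ K (-Λ) := by
  intro φ hφ x r C hr hC h0 hb
  simpa using h φ hφ x r C hr hC h0 hb

theorem AtomBounded.abs_le {M : Type*} [MetricSpace M] [MeasurableSpace M] [BorelSpace M]
    {μ : Measure M} [IsLocallyFiniteMeasure μ] {K : ℝ} {Λ : C_c(M, ℝ) →ₗ[ℝ] ℝ} (hΛ : AtomBounded μ K Λ)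
    {x : M} {r C : ℝ} (hr : 0 < r) {φ θ : C_c(M, ℝ)} (hθ0 : ∀ y ∉ ball x r, θ y = 0)
    (hI : 0 < ∫ y, θ y ∂μ) (hC : 0 ≤ C) (hφ0 : ∀ y ∉ ball x r, φ y = 0)
    (hb : ∀ y, |φ y - (∫ z, φ z ∂μ) / (∫ z, θ z ∂μ) * θ y| ≤ C) :
    |Λ φ - (∫ z, φ z ∂μ) / (∫ z, θ z ∂μ) * Λ θ| ≤ K * C * (μ (ball x r)).toReal := by
  set t := (∫ z, φ z ∂μ) / (∫ z, θ z ∂μ) with ht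
  have := hΛ (φ - t • θ) ?_ x r C hr hC (fun y hy => by simp [hθ0 y hy, hφ0 y hy])
    (fun y => by simpa using hb y)
  · simpa using this
  · simp only [CompactlySupportedContinuousMap.coe_sub, CompactlySupportedContinuousMap.coe_smul,
      Pi.sub_apply, Pi.smul_apply, smul_eq_mul]
    rw [integral_sub φ.integrable (θ.integrable.const_mul t), integral_const_mul, ht,
      div_mul_cancel₀ _ hI.ne', sub_self]

theorem AtomBounded.measure_inter_ball_le {M : Type*} [MetricSpace M] [LocallyCompactSpace M]
    [MeasurableSpace M] [BorelSpace M] {μ : Measure M} [IsLocallyFiniteMeasure μ]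
    [μ.IsOpenPosMeasure] [μ.OuterRegular]
    {K : ℝ} (hK : 0 ≤ K) {Λ : C_c(M, ℝ) →ₗ[ℝ] ℝ} (hΛ : AtomBounded μ K Λ)
    {ν : Measure M} [ν.Regular]
    (hν : ∀ f : C_c(M, ℝ), 0 ≤ f → IsLUB (Λ '' Set.Icc 0 f) (∫ x, f x ∂ν))
    {E : Set M} (hE : μ E = 0) (x : M) {r : ℝ} (hr : 0 < r) (hfin : μ (ball x r) ≠ ⊤) :
    ν (E ∩ ball x r) ≤ ENNReal.ofReal (K + 1) * μ (ball x r) := by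
  obtain ⟨θ, hθ0, hθnn, hθ1, hI⟩ := exists_bump_ball μ x hr
  set I := ∫ y, θ y ∂μ with hIdef
  set m := (μ (ball x r)).toReal with hm
  have hmpos : 0 < m := ENNReal.toReal_pos (measure_ball_pos μ x hr).ne' hfin
  obtain ⟨δ, hδ, hδI, hδm⟩ : ∃ δ : ℝ, 0 < δ ∧ δ ≤ I ∧ δ / I * |Λ θ| ≤ m := by
    refine ⟨min I (m * I / (|Λ θ| + 1)), by positivity, min_le_left _ _, ?_⟩
    calc min I (m * I / (|Λ θ| + 1)) / I * |Λ θ|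
        ≤ (m * I / (|Λ θ| + 1)) / I * (|Λ θ| + 1) := by
          gcongr
          · exact min_le_right _ _
          · linarith
      _ = m := by field_simp
  obtain ⟨U₀, hEU, hUo, hUδ⟩ := E.exists_isOpen_lt_of_lt (μ := μ) (ENNReal.ofReal δ)
    (by simpa [hE] using hδ)
  have hUopen : IsOpen (U₀ ∩ ball x r) := hUo.inter isOpen_ball
  have hμU : μ.real (U₀ ∩ ball x r) ≤ δ :=
    ENNReal.toReal_le_of_le_ofReal hδ.le ((measure_mono Set.inter_subset_left).trans hUδ.le)
  have hUfin : μ (U₀ ∩ ball x r) ≠ ⊤ := measure_ne_top_of_subset Set.inter_subset_right hfin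
  refine (measure_mono (Set.inter_subset_inter_left _ hEU)).trans ?_
  rw [hUopen.measure_eq_iSup_isCompact]
  refine iSup₂_le fun L hLU => iSup_le fun hL => ?_
  obtain ⟨χ, hχ1, hχc, hχs, hχ01⟩ := exists_continuousMap_one_of_isCompact_subset_isOpen
    hL hUopen hLU
  let X : C_c(M, ℝ) := ⟨χ, hχc⟩
  have hX0 : ∀ y ∉ U₀ ∩ ball x r, X y = 0 := fun y hy =>
    image_eq_zero_of_notMem_tsupport fun h => hy (hχs h)
  have hle : ∫ y, X y ∂ν ≤ (K + 1) * m := by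
    refine (hν X fun y => (hχ01 y).1).2 ?_
    rintro _ ⟨g, ⟨hg0, hg1⟩, rfl⟩
    have hgnn : ∀ y, 0 ≤ g y := fun y => hg0 y
    have hg0' : ∀ y ∉ U₀ ∩ ball x r, g y = 0 := fun y hy =>
      le_antisymm ((hg1 y).trans (hX0 y hy).le) (hgnn y)
    have hgle : ∀ y, g y ≤ 1 := fun y => (hg1 y).trans (hχ01 y).2
    have hgint : ∫ y, g y ∂μ ≤ δ := by
      rw [← setIntegral_eq_integral_of_forall_compl_eq_zero hg0']
      calc ∫ y in U₀ ∩ ball x r, g y ∂μ ≤ ∫ y in U₀ ∩ ball x r, (1 : ℝ) ∂μ :=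
            setIntegral_mono g.integrable.integrableOn (integrableOn_const hUfin) hgle
        _ ≤ δ := by simpa using hμU
    have hgint0 : 0 ≤ ∫ y, g y ∂μ := integral_nonneg hgnn
    have ht0 : 0 ≤ (∫ y, g y ∂μ) / I := by positivity
    have ht1 : (∫ y, g y ∂μ) / I ≤ δ / I := by gcongr
    have ht2 : (∫ y, g y ∂μ) / I ≤ 1 := (div_le_one hI).2 (hgint.trans hδI)
    have key := hΛ.abs_le (C := 1) hr hθ0 hI zero_le_one
      (fun y hy => hg0' y fun h => hy h.2) fun y => by
        rw [_root_.abs_le]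
        have h1 := mul_nonneg ht0 (hθnn y)
        have h2 := mul_le_one₀ ht2 (hθnn y) (hθ1 y)
        constructor <;> linarith [hgnn y, hgle y]
    have h3 : (∫ y, g y ∂μ) / I * Λ θ ≤ m :=
      calc (∫ y, g y ∂μ) / I * Λ θ ≤ (∫ y, g y ∂μ) / I * |Λ θ| := by gcongr; exact le_abs_self _
        _ ≤ δ / I * |Λ θ| := by gcongr
        _ ≤ m := hδm
    have := (_root_.abs_le.1 key).2
    rw [mul_one] at this
    linarith
  calc ν L = ∫⁻ y in L, 1 ∂ν := by simp
    _ ≤ ∫⁻ y in L, ENNReal.ofReal (X y) ∂ν := by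
        refine setLIntegral_mono' hL.measurableSet fun y hy => ?_
        have : X y = 1 := hχ1 hy
        simp [this]
    _ ≤ ∫⁻ y, ENNReal.ofReal (X y) ∂ν := setLIntegral_le_lintegral _ _
    _ = ENNReal.ofReal (∫ y, X y ∂ν) :=
        (ofReal_integral_eq_lintegral_ofReal X.integrable (.of_forall fun y => (hχ01 y).1)).symm
    _ ≤ ENNReal.ofReal ((K + 1) * m) := ENNReal.ofReal_le_ofReal hle
    _ = ENNReal.ofReal (K + 1) * μ (ball x r) := by
        rw [ENNReal.ofReal_mul (by positivity), hm, ENNReal.ofReal_toReal hfin]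

theorem exists_compactlySupported_approx_piecewise {M : Type*} [MetricSpace M]
    [LocallyCompactSpace M] [SecondCountableTopology M] [MeasurableSpace M] [BorelSpace M]
    {μ : Measure M} {B S : Set M}
    (hB : IsOpen B) (hS : MeasurableSet S) [DecidablePred (· ∈ S)] {w : M → ℝ}
    (hw : IntegrableOn w B μ) {p q C : ℝ} (hp : 0 ≤ p) (hq : q ≤ 0) (hpC : p ≤ C) (hqC : -C ≤ q)
    {ε : ℝ} (hε : 0 < ε) :
    ∃ h : C_c(M, ℝ), (∀ y ∉ B, h y = 0) ∧ (∀ y, |h y| ≤ C) ∧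
      ∫ y in B, ‖w y‖ * |h y - S.piecewise (fun _ => p) (fun _ => q) y| ∂μ ≤ ε := by
  have hC : 0 ≤ C := hp.trans hpC
  obtain ⟨δ, hδ, hδε⟩ : ∃ δ : ℝ, 0 < δ ∧ 4 * C * δ ≤ ε := by
    refine ⟨ε / (4 * C + 1), by positivity, ?_⟩
    rw [mul_div_assoc', div_le_iff₀ (by positivity)]
    nlinarith
  let ρ : Measure M := (μ.restrict B).withDensity fun y => ‖w y‖ₑ
  have : IsFiniteMeasure ρ := isFiniteMeasure_withDensity hw.2.ne
  have hδ' : ENNReal.ofReal δ ≠ 0 := by simpa using hδ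
  obtain ⟨K₁, hK₁, hK₁c, hK₁δ⟩ := (hS.inter hB.measurableSet).exists_isCompact_sdiff_lt (μ := ρ)
    (measure_ne_top _ _) hδ'
  obtain ⟨K₂, hK₂, hK₂c, hK₂δ⟩ := (hB.measurableSet.diff hS).exists_isCompact_sdiff_lt (μ := ρ)
    (measure_ne_top _ _) hδ'
  have hdisj : Disjoint K₁ K₂ :=
    Set.disjoint_left.2 fun y h1 h2 => (hK₂ h2).2 (hK₁ h1).1
  obtain ⟨f₁, h₁1, h₁c, h₁s, h₁01⟩ := exists_continuousMap_one_of_isCompact_subset_isOpen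
    hK₁c (hB.sdiff hK₂c.isClosed) fun y hy => ⟨(hK₁ hy).2, fun h => hdisj.notMem_of_mem_left hy h⟩
  obtain ⟨f₂, h₂1, h₂c, h₂s, h₂01⟩ := exists_continuousMap_one_of_isCompact_subset_isOpen
    hK₂c (hB.sdiff hK₁c.isClosed) fun y hy => ⟨(hK₂ hy).1, fun h => hdisj.notMem_of_mem_left h hy⟩
  have h₁0 : ∀ y ∉ B \ K₂, f₁ y = 0 := fun y hy =>
    image_eq_zero_of_notMem_tsupport fun h => hy (h₁s h)
  have h₂0 : ∀ y ∉ B \ K₁, f₂ y = 0 := fun y hy =>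
    image_eq_zero_of_notMem_tsupport fun h => hy (h₂s h)
  let h : C_c(M, ℝ) := p • ⟨f₁, h₁c⟩ + q • ⟨f₂, h₂c⟩
  have hh : ∀ y, h y = p * f₁ y + q * f₂ y := fun y => rfl
  have hb : ∀ y, |h y| ≤ C := by
    intro y
    rw [hh, abs_le]
    have a1 := mul_nonneg hp (h₁01 y).1
    have a2 := mul_le_of_le_one_right hp (h₁01 y).2
    have b1 := mul_nonneg (neg_nonneg.2 hq) (h₂01 y).1
    have b2 := mul_le_of_le_one_right (neg_nonneg.2 hq) (h₂01 y).2
    constructor <;> linarith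
  have hg : ∀ y, |S.piecewise (fun _ => p) (fun _ => q) y| ≤ C := by
    intro y
    by_cases hy : y ∈ S
    · rw [Set.piecewise_eq_of_mem _ _ _ hy, abs_le]; constructor <;> linarith
    · rw [Set.piecewise_eq_of_notMem _ _ _ hy, abs_le]; constructor <;> linarith
  refine ⟨h, fun y hy => ?_, hb, ?_⟩
  · rw [hh, h₁0 y fun h => hy h.1, h₂0 y fun h => hy h.1]; simp
  let N := ((S ∩ B) \ K₁) ∪ ((B \ S) \ K₂)
  have hNmeas : MeasurableSet N := ((hS.inter hB.measurableSet).diff hK₁c.measurableSet).union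
    ((hB.measurableSet.diff hS).diff hK₂c.measurableSet)
  have hNB : N ⊆ B := Set.union_subset (fun y hy => hy.1.2) fun y hy => hy.1.1
  have hwN : ∫ y in N, ‖w y‖ ∂μ ≤ 2 * δ := by
    rw [← ENNReal.ofReal_le_ofReal_iff (by positivity),
      ofReal_integral_norm_eq_lintegral_enorm (hw.mono_set hNB)]
    calc ∫⁻ y in N, ‖w y‖ₑ ∂μ = ρ N := by
          rw [withDensity_apply _ hNmeas, Measure.restrict_restrict hNmeas,
            Set.inter_eq_left.2 hNB]
      _ ≤ ENNReal.ofReal δ + ENNReal.ofReal δ :=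
          (measure_union_le _ _).trans (add_le_add hK₁δ.le hK₂δ.le)
      _ = ENNReal.ofReal (2 * δ) := by rw [← ENNReal.ofReal_add hδ.le hδ.le, two_mul]
  calc ∫ y in B, ‖w y‖ * |h y - S.piecewise (fun _ => p) (fun _ => q) y| ∂μ
      ≤ ∫ y in B, N.indicator (fun y => 2 * C * ‖w y‖) y ∂μ := by
        refine integral_mono_of_nonneg (.of_forall fun y => by positivity)
          ((hw.norm.const_mul (2 * C)).indicator hNmeas) ?_
        filter_upwards [ae_restrict_mem hB.measurableSet] with y hyB
        by_cases hyN : y ∈ N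
        · rw [Set.indicator_of_mem hyN, mul_comm]
          gcongr
          refine (abs_sub _ _).trans ?_
          linarith [hb y, hg y]
        · rw [Set.indicator_of_notMem hyN]
          refine (mul_eq_zero_of_right _ ?_).le
          rw [abs_eq_zero, sub_eq_zero, hh]
          by_cases hyS : y ∈ S
          · have hy1 : y ∈ K₁ := by_contra fun hy => hyN (Or.inl ⟨⟨hyS, hyB⟩, hy⟩)
            rw [Set.piecewise_eq_of_mem _ _ _ hyS, h₁1 hy1, h₂0 y fun h => h.2 hy1]
            simp
          · have hy2 : y ∈ K₂ := by_contra fun hy => hyN (Or.inr ⟨⟨hyB, hyS⟩, hy⟩)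
            rw [Set.piecewise_eq_of_notMem _ _ _ hyS, h₂1 hy2, h₁0 y fun h => h.2 hy2]
            simp
    _ = 2 * C * ∫ y in N, ‖w y‖ ∂μ := by
        rw [integral_indicator hNmeas, Measure.restrict_restrict hNmeas,
          Set.inter_eq_left.2 hNB, integral_const_mul]
    _ ≤ 2 * C * (2 * δ) := by gcongr
    _ ≤ ε := by linarith

theorem AtomBounded.abs_setIntegral_mul_piecewise_le {M : Type*} [MetricSpace M]
    [LocallyCompactSpace M] [SecondCountableTopology M] [MeasurableSpace M] [BorelSpace M]
    {μ : Measure M} [IsLocallyFiniteMeasure μ] [μ.IsOpenPosMeasure] {K : ℝ} (hK : 0 ≤ K)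
    {Λ : C_c(M, ℝ) →ₗ[ℝ] ℝ} (hΛ : AtomBounded μ K Λ) {f : M → ℝ}
    (hfΛ : ∀ φ : C_c(M, ℝ), ∫ y, f y * φ y ∂μ = Λ φ) {x : M} {r : ℝ} (hr : 0 < r)
    (hfin : μ (ball x r) ≠ ⊤) (hfB : IntegrableOn f (ball x r) μ) {S : Set M}
    (hS : MeasurableSet S) [DecidablePred (· ∈ S)] {p q C : ℝ} (hp : 0 ≤ p) (hq : q ≤ 0)
    (hpC : p ≤ C) (hqC : -C ≤ q)
    (hmean : ∫ y in ball x r, S.piecewise (fun _ => p) (fun _ => q) y ∂μ = 0) :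
    ∫ y in ball x r, f y * S.piecewise (fun _ => p) (fun _ => q) y ∂μ ≤
      K * C * (μ (ball x r)).toReal := by
  obtain ⟨θ, hθ0, hθnn, hθ1, hI⟩ := exists_bump_ball μ x hr
  set I := ∫ y, θ y ∂μ with hIdef
  set m := (μ (ball x r)).toReal with hm
  set g := S.piecewise (fun _ => p) (fun _ => q) with hgdef
  have hC : 0 ≤ C := hp.trans hpC
  have hgmeas : Measurable g := Measurable.piecewise hS measurable_const measurable_const
  have hgb : ∀ y, ‖g y‖ ≤ C := by
    intro y
    rw [Real.norm_eq_abs, hgdef]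
    by_cases hy : y ∈ S
    · rw [Set.piecewise_eq_of_mem _ _ _ hy, _root_.abs_le]; constructor <;> linarith
    · rw [Set.piecewise_eq_of_notMem _ _ _ hy, _root_.abs_le]; constructor <;> linarith
  suffices H : ∀ ε : ℝ, 0 < ε → ∫ y in ball x r, f y * g y ∂μ ≤
      K * C * m + ε * (1 + (K * m + |Λ θ|) / I) by
    have hA : 0 < 1 + (K * m + |Λ θ|) / I := by positivity
    refine le_of_forall_pos_le_add fun η hη => ?_
    have := H (η / (1 + (K * m + |Λ θ|) / I)) (by positivity)
    rwa [div_mul_cancel₀ _ hA.ne'] at this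
  intro ε hε
  have hw : IntegrableOn (fun y => 1 + ‖f y‖) (ball x r) μ :=
    (integrableOn_const hfin).add hfB.norm
  obtain ⟨h, h0, hhC, happ⟩ := exists_compactlySupported_approx_piecewise isOpen_ball hS hw
    hp hq hpC hqC hε
  rw [← hgdef] at happ
  have hgB : IntegrableOn g (ball x r) μ :=
    (integrableOn_const (C := C) hfin).mono' hgmeas.aestronglyMeasurable (.of_forall hgb)
  have hfg : IntegrableOn (fun y => f y * g y) (ball x r) μ :=
    hfB.mul_bdd (c := C) hgmeas.aestronglyMeasurable (.of_forall hgb)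
  have hfh : IntegrableOn (fun y => f y * h y) (ball x r) μ :=
    hfB.mul_bdd (c := C) h.continuous.aestronglyMeasurable (.of_forall hhC)
  have hdiff : IntegrableOn (fun y => ‖1 + ‖f y‖‖ * |h y - g y|) (ball x r) μ :=
    hw.norm.mul_bdd (c := C + C)
      (h.continuous.measurable.sub hgmeas).abs.aestronglyMeasurable (.of_forall fun y => by
        rw [Real.norm_eq_abs, abs_abs]
        exact (abs_sub _ _).trans (add_le_add (hhC y) (hgb y)))
  have hwnorm : ∀ y, ‖1 + ‖f y‖‖ = 1 + ‖f y‖ := fun y => Real.norm_of_nonneg (by positivity)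
  have e1 : |(∫ y, h y ∂μ)| ≤ ε := by
    rw [← setIntegral_eq_integral_of_forall_compl_eq_zero h0, ← sub_zero (∫ y in _, _ ∂μ), ← hmean,
      ← integral_sub h.integrable.integrableOn hgB]
    refine (abs_integral_le_integral_abs).trans (le_trans ?_ happ)
    refine integral_mono_of_nonneg (.of_forall fun y => abs_nonneg _) hdiff
      (.of_forall fun y => ?_)
    simp only [hwnorm]
    nlinarith [abs_nonneg (h y - g y), norm_nonneg (f y)]
  have e2 : (∫ y in ball x r, f y * g y ∂μ) - ∫ y, f y * h y ∂μ ≤ ε := by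
    rw [← setIntegral_eq_integral_of_forall_compl_eq_zero
      (s := ball x r) (f := fun y => f y * h y) fun y hy => by rw [h0 y hy, mul_zero],
      ← integral_sub hfg hfh]
    refine (le_abs_self _).trans ((abs_integral_le_integral_abs).trans (le_trans ?_ happ))
    refine integral_mono_of_nonneg (.of_forall fun y => abs_nonneg _) hdiff
      (.of_forall fun y => ?_)
    simp only [hwnorm]
    rw [← mul_sub, abs_mul, abs_sub_comm (g y)]
    gcongr
    rw [Real.norm_eq_abs]
    linarith
  rw [hfΛ] at e2
  have ht : |(∫ y, h y ∂μ) / I| ≤ ε / I := by rw [abs_div, abs_of_pos hI]; gcongr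
  have key := hΛ.abs_le (C := C + ε / I) hr hθ0 hI (by positivity) h0 fun y => by
    refine (abs_sub _ _).trans (add_le_add (hhC y) ?_)
    rw [abs_mul, abs_of_nonneg (hθnn y)]
    exact (mul_le_of_le_one_right (abs_nonneg _) (hθ1 y)).trans ht
  have h3 : (∫ y, h y ∂μ) / I * Λ θ ≤ ε / I * |Λ θ| := by
    refine (le_abs_self _).trans ?_
    rw [abs_mul]
    gcongr
  have h4 := (_root_.abs_le.1 key).2
  have h5 : ε * (1 + (K * m + |Λ θ|) / I) = ε + K * (ε / I) * m + ε / I * |Λ θ| := by ring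
  rw [h5]
  linarith

theorem AtomBounded.setIntegral_abs_sub_average_le {M : Type*} [MetricSpace M]
    [LocallyCompactSpace M] [SecondCountableTopology M] [MeasurableSpace M] [BorelSpace M]
    {μ : Measure M} [IsLocallyFiniteMeasure μ] [μ.IsOpenPosMeasure] {K : ℝ} (hK : 0 ≤ K)
    {Λ : C_c(M, ℝ) →ₗ[ℝ] ℝ} (hΛ : AtomBounded μ K Λ) {f : M → ℝ} (hfm : Measurable f)
    (hfΛ : ∀ φ : C_c(M, ℝ), ∫ y, f y * φ y ∂μ = Λ φ) (x : M) {r : ℝ}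
    (hr : 0 < r) (hfin : μ (ball x r) ≠ ⊤) :
    ∫ y in ball x r, |f y - ⨍ z in ball x r, f z ∂μ| ∂μ ≤ 2 * K * (μ (ball x r)).toReal := by
  classical
  set c := ⨍ z in ball x r, f z ∂μ with hc
  set m := (μ (ball x r)).toReal with hm
  have hmpos : 0 < m := ENNReal.toReal_pos (measure_ball_pos μ x hr).ne' hfin
  by_cases hfB : IntegrableOn f (ball x r) μ
  swap
  · have hnot : ¬ IntegrableOn (fun y => |f y - c|) (ball x r) μ := by
      intro h
      have h' : IntegrableOn (fun y => f y - c) (ball x r) μ :=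
        (integrable_norm_iff (hfm.sub_const c).aestronglyMeasurable).1 h
      exact hfB ((h'.add (integrableOn_const (C := c) hfin)).congr
        (.of_forall fun y => sub_add_cancel (f y) c))
    rw [integral_undef hnot]
    positivity
  have hconst : ∀ a : ℝ, IntegrableOn (fun _ => a) (ball x r) μ := fun a => integrableOn_const hfin
  let S : Set M := {y | c ≤ f y}
  have hS : MeasurableSet S := measurableSet_le measurable_const hfm
  have hfc : ∫ y in ball x r, (f y - c) ∂μ = 0 := by
    have : IsFiniteMeasure (μ.restrict (ball x r)) := ⟨by simpa using hfin.lt_top⟩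
    exact integral_sub_average _ f
  let s : M → ℝ := S.piecewise (fun _ => 1) (fun _ => -1)
  have hsm : Measurable s := Measurable.piecewise hS measurable_const measurable_const
  have hs1 : ∀ y, ‖s y‖ ≤ 1 := by
    intro y
    by_cases hy : y ∈ S <;> simp [s, hy]
  have hsB : IntegrableOn s (ball x r) μ :=
    (hconst 1).mono' hsm.aestronglyMeasurable (.of_forall hs1)
  set a := (∫ y in ball x r, s y ∂μ) / m with ha
  have ha1 : |a| ≤ 1 := by
    rw [ha, abs_div, abs_of_pos hmpos, div_le_one hmpos]
    simpa [Measure.real] using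
      norm_setIntegral_le_of_norm_le_const (μ := μ) hfin.lt_top fun y _ => hs1 y
  obtain ⟨ha2, ha3⟩ := _root_.abs_le.1 ha1
  let g : M → ℝ := S.piecewise (fun _ => 1 - a) (fun _ => -1 - a)
  have hgs : ∀ y, g y = s y - a := by
    intro y
    by_cases hy : y ∈ S <;> simp [g, s, hy]
  have hmean : ∫ y in ball x r, g y ∂μ = 0 := by
    simp only [hgs]
    rw [integral_sub hsB (hconst a), setIntegral_const, smul_eq_mul, Measure.real, ← hm, ha,
      mul_div_cancel₀ _ hmpos.ne', sub_self]
  have hgB : IntegrableOn g (ball x r) μ :=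
    (hsB.sub (hconst a)).congr (.of_forall fun y => (hgs y).symm)
  have hfg : IntegrableOn (fun y => f y * g y) (ball x r) μ := by
    refine hfB.mul_bdd (c := 2)
      (Measurable.piecewise hS measurable_const measurable_const).aestronglyMeasurable
      (.of_forall fun y => ?_)
    rw [hgs]
    refine (norm_sub_le _ _).trans ?_
    rw [Real.norm_eq_abs a]
    linarith [hs1 y]
  have hle := hΛ.abs_setIntegral_mul_piecewise_le hK hfΛ hr hfin hfB hS (p := 1 - a)
    (q := -1 - a) (C := 2) (by linarith) (by linarith) (by linarith) (by linarith) hmean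
  calc ∫ y in ball x r, |f y - c| ∂μ
      = ∫ y in ball x r, (f y * g y - c * g y + a * (f y - c)) ∂μ := by
        congr 1
        ext y
        rw [hgs]
        by_cases hy : y ∈ S
        · have : 0 ≤ f y - c := sub_nonneg.2 hy
          rw [abs_of_nonneg this]
          simp only [s, Set.piecewise_eq_of_mem _ _ _ hy]
          ring
        · have : f y - c < 0 := sub_neg.2 (not_le.1 hy)
          rw [abs_of_neg this]
          simp only [s, Set.piecewise_eq_of_notMem _ _ _ hy]
          ring
    _ = ∫ y in ball x r, f y * g y ∂μ := by
        have h1 : IntegrableOn (fun y => f y * g y - c * g y) (ball x r) μ :=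
          hfg.sub (hgB.const_mul c)
        have h2 : IntegrableOn (fun y => a * (f y - c)) (ball x r) μ :=
          (hfB.sub (hconst c)).const_mul a
        rw [integral_add h1 h2, integral_sub hfg (hgB.const_mul c), integral_const_mul, integral_const_mul, hmean, hfc]
        simp
    _ ≤ 2 * K * m := by linarith

theorem AtomBounded.exists_locallyIntegrable {M : Type*} [MetricSpace M]
    [LocallyCompactSpace M] [SecondCountableTopology M] [MeasurableSpace M] [BorelSpace M]
    {μ : Measure M} [IsLocallyFiniteMeasure μ] [μ.IsOpenPosMeasure]
    (hfin : ∀ (x : M) (r : ℝ), 0 < r → μ (ball x r) ≠ ⊤) {D : ℝ≥0∞} (hD : D ≠ ⊤)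
    (hdoub : ∀ (x : M) (r : ℝ), 0 < r → μ (ball x (2 * r)) ≤ D * μ (ball x r))
    {K : ℝ} (hK : 0 ≤ K) {Λ : C_c(M, ℝ) →ₗ[ℝ] ℝ} (hΛ : AtomBounded μ K Λ)
    (hbdd : ∀ f : C_c(M, ℝ), 0 ≤ f → ∃ C, ∀ g ∈ Set.Icc 0 f, |Λ g| ≤ C) :
    ∃ f : M → ℝ, Measurable f ∧ LocallyIntegrable f μ ∧
      ∀ φ : C_c(M, ℝ), ∫ y, f y * φ y ∂μ = Λ φ := by
  have key : ∀ L : C_c(M, ℝ) →ₗ[ℝ] ℝ, AtomBounded μ K L →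
      (∀ f : C_c(M, ℝ), 0 ≤ f → ∃ C, ∀ g ∈ Set.Icc 0 f, |L g| ≤ C) →
      ∃ ν : Measure M, ν.Regular ∧ ν ≪ μ ∧ ∀ f : C_c(M, ℝ), 0 ≤ f →
        IsLUB (L '' Set.Icc 0 f) (∫ x, f x ∂ν) := by
    intro L hL hLb
    obtain ⟨ν, hν, hlub⟩ := exists_regular_isLUB_integral L fun f hf => by
      obtain ⟨C, hC⟩ := hLb f hf
      exact ⟨C, by rintro _ ⟨g, hg, rfl⟩; exact (le_abs_self _).trans (hC g hg)⟩
    exact ⟨ν, hν, absolutelyContinuous_of_measure_inter_ball_le μ ν hD ENNReal.ofReal_ne_top hdoub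
      fun E hE x r hr => hL.measure_inter_ball_le hK hlub hE x hr (hfin x r hr), hlub⟩
  obtain ⟨ν₁, hν₁, hac₁, hlub₁⟩ := key Λ hΛ hbdd
  obtain ⟨ν₂, hν₂, hac₂, hlub₂⟩ := key (-Λ) hΛ.neg fun f hf => by
    obtain ⟨C, hC⟩ := hbdd f hf
    exact ⟨C, fun g hg => by simpa using hC g hg⟩
  have hnonneg : ∀ φ : C_c(M, ℝ), 0 ≤ φ → Λ φ = ∫ x, φ x ∂ν₁ - ∫ x, φ x ∂ν₂ := fun φ hφ =>
    isLUB_image_Icc_unique Λ (hlub₁ φ hφ) (hlub₂ φ hφ)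
  have hloc : ∀ ν : Measure M, ν.Regular → LocallyIntegrable (fun y => (ν.rnDeriv μ y).toReal) μ := by
    intro ν hν
    rw [locallyIntegrable_iff]
    exact fun k hk => Measure.integrableOn_toReal_rnDeriv hk.measure_ne_top
  have hint : ∀ ν : Measure M, ν.Regular → ∀ φ : C_c(M, ℝ),
      Integrable (fun y => (ν.rnDeriv μ y).toReal * φ y) μ := by
    intro ν hν φ
    exact (hloc ν hν).integrable_smul_right_of_hasCompactSupport φ.continuous φ.hasCompactSupport
  have hrn : ∀ ν : Measure M, ν.Regular → ν ≪ μ → ∀ φ : C_c(M, ℝ),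
      ∫ y, (ν.rnDeriv μ y).toReal * φ y ∂μ = ∫ y, φ y ∂ν := by
    intro ν hν hac φ
    exact integral_rnDeriv_smul hac
  refine ⟨fun y => (ν₁.rnDeriv μ y).toReal - (ν₂.rnDeriv μ y).toReal,
    (Measure.measurable_rnDeriv _ _).ennreal_toReal.sub
      (Measure.measurable_rnDeriv _ _).ennreal_toReal,
    (hloc ν₁ hν₁).sub (hloc ν₂ hν₂), fun φ => ?_⟩
  simp only [sub_mul]
  rw [integral_sub (hint ν₁ hν₁ φ) (hint ν₂ hν₂ φ), hrn ν₁ hν₁ hac₁, hrn ν₂ hν₂ hac₂]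
  have hpos : 0 ≤ φ ⊔ 0 := le_sup_right
  have hneg : 0 ≤ φ ⊔ 0 - φ := sub_nonneg.2 le_sup_left
  have h1 := hnonneg _ hpos
  have h2 := hnonneg _ hneg
  rw [map_sub] at h2
  simp only [CompactlySupportedContinuousMap.coe_sub, Pi.sub_apply] at h2
  rw [integral_sub (φ ⊔ 0).integrable φ.integrable,
    integral_sub (φ ⊔ 0).integrable φ.integrable] at h2
  linarith

theorem abs_le_of_forall_oneInfAtom {M : Type*} [MetricSpace M] [MeasurableSpace M] [BorelSpace M]
    {μ : Measure M} (hμ : ∀ (x : M) (r : ℝ), 0 < r → 0 < μ (ball x r) ∧ μ (ball x r) < ⊤)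
    {lam : (M → ℝ) → ℝ} {K : ℝ}
    (hsmul : ∀ (c : ℝ) (φ : M → ℝ), MemV μ φ → lam (c • φ) = c * lam φ)
    (hbound : ∀ a : M → ℝ, IsOneInfAtom μ a → Continuous a → HasCompactSupport a → |lam a| ≤ K)
    {φ : M → ℝ} (hφ : MemV μ φ) {x : M} {r C : ℝ} (hr : 0 < r) (hC : 0 ≤ C)
    (h0 : ∀ y ∉ ball x r, φ y = 0) (hb : ∀ y, |φ y| ≤ C) :
    |lam φ| ≤ K * C * (μ (ball x r)).toReal := by
  rcases hC.eq_or_lt with rfl | hC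
  · have hφ0 : φ = (0 : ℝ) • φ := by
      ext y
      simpa using hb y
    rw [hφ0, hsmul 0 φ hφ]
    simp
  have hm : 0 < (μ (ball x r)).toReal := ENNReal.toReal_pos (hμ x r hr).1.ne' (hμ x r hr).2.ne
  set m := (μ (ball x r)).toReal with hmdef
  have hCm : 0 < C * m := by positivity
  have hcont : Continuous ((C * m)⁻¹ • φ) := hφ.1.const_smul _
  have := hbound ((C * m)⁻¹ • φ) ⟨hcont.measurable, x, r, hr, fun y hy => by simp [h0 y hy],
    .of_forall fun y => ?_, ?_⟩ hcont (hφ.2.1.smul_left (f := fun _ => (C * m)⁻¹))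
  · rw [hsmul _ _ hφ, abs_mul, abs_of_pos (inv_pos.2 hCm), inv_mul_le_iff₀ hCm] at this
    linarith
  · rw [Pi.smul_apply, smul_eq_mul, abs_mul, abs_of_pos (inv_pos.2 hCm), inv_mul_le_iff₀ hCm,
      mul_assoc, mul_inv_cancel₀ hm.ne', mul_one]
    exact hb y
  · simp only [Pi.smul_apply, smul_eq_mul]
    rw [integral_const_mul, hφ.2.2, mul_zero]

theorem exists_atomBounded_extension {M : Type*} [MetricSpace M] [LocallyCompactSpace M]
    [MeasurableSpace M] [BorelSpace M] {μ : Measure M} [IsLocallyFiniteMeasure μ]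
    [μ.IsOpenPosMeasure]
    (hμ : ∀ (x : M) (r : ℝ), 0 < r → 0 < μ (ball x r) ∧ μ (ball x r) < ⊤) (x₀ : M)
    {lam : (M → ℝ) → ℝ} {K : ℝ}
    (hadd : ∀ φ ψ : M → ℝ, MemV μ φ → MemV μ ψ → lam (φ + ψ) = lam φ + lam ψ)
    (hsmul : ∀ (c : ℝ) (φ : M → ℝ), MemV μ φ → lam (c • φ) = c * lam φ)
    (hbound : ∀ a : M → ℝ, IsOneInfAtom μ a → Continuous a → HasCompactSupport a → |lam a| ≤ K) :
    ∃ Λ : C_c(M, ℝ) →ₗ[ℝ] ℝ, AtomBounded μ K Λ ∧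
      (∀ f : C_c(M, ℝ), 0 ≤ f → ∃ C, ∀ g ∈ Set.Icc 0 f, |Λ g| ≤ C) ∧
      ∀ φ : C_c(M, ℝ), (∫ y, φ y ∂μ) = 0 → Λ φ = lam φ := by
  obtain ⟨θ, hθ0, hθnn, hθ1, hI⟩ := exists_bump_ball μ x₀ one_pos
  set I := ∫ y, θ y ∂μ with hIdef
  let P : C_c(M, ℝ) → C_c(M, ℝ) := fun φ => φ - ((∫ y, φ y ∂μ) / I) • θ
  have hPapp : ∀ φ y, P φ y = φ y - (∫ y, φ y ∂μ) / I * θ y := fun φ y => rfl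
  have hPV : ∀ φ, MemV μ (P φ) := by
    intro φ
    refine ⟨(P φ).continuous, (P φ).hasCompactSupport, ?_⟩
    simp only [hPapp]
    rw [integral_sub φ.integrable (θ.integrable.const_mul _), integral_const_mul,
      div_mul_cancel₀ _ hI.ne', sub_self]
  have hP0 : ∀ φ : C_c(M, ℝ), (∫ y, φ y ∂μ) = 0 → P φ = φ := by
    intro φ hφ
    simp [P, hφ]
  have hPadd : ∀ φ ψ, ⇑(P (φ + ψ)) = P φ + P ψ := by
    intro φ ψ
    ext y
    simp only [hPapp, Pi.add_apply, CompactlySupportedContinuousMap.coe_add]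
    rw [integral_add φ.integrable ψ.integrable]
    ring
  have hPsmul : ∀ (c : ℝ) φ, ⇑(P (c • φ)) = c • ⇑(P φ) := by
    intro c φ
    ext y
    simp only [hPapp, Pi.smul_apply, CompactlySupportedContinuousMap.coe_smul, smul_eq_mul]
    rw [integral_const_mul]
    ring
  let Λ : C_c(M, ℝ) →ₗ[ℝ] ℝ :=
    { toFun := fun φ => lam (P φ)
      map_add' := fun φ ψ => by rw [hPadd, hadd _ _ (hPV φ) (hPV ψ)]
      map_smul' := fun c φ => by rw [hPsmul, hsmul _ _ (hPV φ)]; rfl }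
  have hΛ : ∀ φ, Λ φ = lam (P φ) := fun φ => rfl
  refine ⟨Λ, ?_, ?_, fun φ hφ => by rw [hΛ, hP0 φ hφ]⟩
  · intro φ hφ x r C hr hC h0 hb
    have hV := hPV φ
    rw [hΛ]
    rw [hP0 φ hφ] at hV ⊢
    exact abs_le_of_forall_oneInfAtom hμ hsmul hbound hV hr hC h0 hb
  · intro f hf
    obtain ⟨R, hR⟩ := (f.hasCompactSupport.isCompact.isBounded).subset_ball x₀
    obtain ⟨A, hA⟩ := f.hasCompactSupport.exists_bound_of_continuous f.continuous
    have hA0 : 0 ≤ A := (norm_nonneg _).trans (hA x₀)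
    have hfint : 0 ≤ ∫ y, f y ∂μ := integral_nonneg fun y => hf y
    refine ⟨K * (A + (∫ y, f y ∂μ) / I) * (μ (ball x₀ (max R 1))).toReal, fun g hg => ?_⟩
    have hg0 : ∀ y, 0 ≤ g y := fun y => hg.1 y
    have hgf : ∀ y, g y ≤ f y := fun y => hg.2 y
    rw [hΛ]
    refine abs_le_of_forall_oneInfAtom hμ hsmul hbound (hPV g) (by positivity) (by positivity)
      (fun y hy => ?_) fun y => ?_
    · have hf0 : f y = 0 := image_eq_zero_of_notMem_tsupport fun h =>
        hy (ball_subset_ball (le_max_left _ _) (hR h))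
      have hgy : g y = 0 := le_antisymm ((hgf y).trans hf0.le) (hg0 y)
      rw [hPapp, hgy, hθ0 y fun h => hy (ball_subset_ball (le_max_right _ _) h)]
      simp
    · have hgint : 0 ≤ ∫ y, g y ∂μ := integral_nonneg hg0
      have hgint' : ∫ y, g y ∂μ ≤ ∫ y, f y ∂μ := integral_mono g.integrable f.integrable hgf
      rw [hPapp]
      refine (abs_sub _ _).trans (add_le_add ?_ ?_)
      · rw [abs_of_nonneg (hg0 y)]
        exact (hgf y).trans ((le_abs_self _).trans (hA y))
      · rw [abs_of_nonneg (mul_nonneg (by positivity) (hθnn y))]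
        refine (mul_le_of_le_one_right (by positivity) (hθ1 y)).trans ?_
        gcongr

/-- A linear functional on the space of continuous compactly supported
mean-zero functions, uniformly bounded by `K` on continuous compactly supported
`(1,∞)`-atoms, is represented by a function `f` with `‖f‖_{BMO} ≤ 2K`. -/
theorem stmt7 {M : Type*} [MetricSpace M] [MeasurableSpace M] [BorelSpace M]
    [LocallyCompactSpace M]
    (μ : Measure M)
    (hμ : ∀ (x : M) (r : ℝ), 0 < r → 0 < μ (ball x r) ∧ μ (ball x r) < ⊤)
    (hinf : μ Set.univ = ⊤)
    (D : ℝ) (hD : 1 ≤ D)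
    (hdoub : ∀ (x : M) (r : ℝ), 0 < r →
      μ (ball x (2 * r)) ≤ ENNReal.ofReal D * μ (ball x r))
    (lam : (M → ℝ) → ℝ) (K : ℝ)
    (hadd : ∀ φ ψ : M → ℝ, MemV μ φ → MemV μ ψ → lam (φ + ψ) = lam φ + lam ψ)
    (hsmul : ∀ (c : ℝ) (φ : M → ℝ), MemV μ φ → lam (c • φ) = c * lam φ)
    (hbound : ∀ a : M → ℝ, IsOneInfAtom μ a → Continuous a → HasCompactSupport a →
      |lam a| ≤ K) :
    ∃ f : M → ℝ, MeasureTheory.LocallyIntegrable f μ ∧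
      (∀ (x : M) (r : ℝ), 0 < r →
        (∫ y in ball x r, |f y - ⨍ z in ball x r, f z ∂μ| ∂μ)
          ≤ 2 * K * (μ (ball x r)).toReal) ∧
      (∀ φ : M → ℝ, MemV μ φ → lam φ = ∫ x, f x * φ x ∂μ) := by
  have hne : Nonempty M := by
    by_contra h
    rw [not_nonempty_iff] at h
    simp [Measure.eq_zero_of_isEmpty μ] at hinf
  obtain ⟨x₀⟩ := hne
  have hsec := secondCountableTopology_of_measure_ball μ hμ
  have hlf : IsLocallyFiniteMeasure μ :=
    ⟨fun x => ⟨ball x 1, ball_mem_nhds x one_pos, (hμ x 1 one_pos).2⟩⟩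
  have hop : μ.IsOpenPosMeasure := by
    refine ⟨fun U hU ⟨x, hx⟩ => ?_⟩
    obtain ⟨r, hr, hrU⟩ := Metric.isOpen_iff.1 hU x hx
    exact ((hμ x r hr).1.trans_le (measure_mono hrU)).ne'
  have hK : 0 ≤ K := (abs_nonneg _).trans <| hbound 0
    ⟨measurable_const, x₀, 1, one_pos, fun _ _ => rfl, .of_forall fun _ => by simp, by simp⟩
    continuous_const HasCompactSupport.zero
  obtain ⟨Λ, hΛ, hbdd, hext⟩ := exists_atomBounded_extension hμ x₀ hadd hsmul hbound
  obtain ⟨f, hfm, hf, hfΛ⟩ := hΛ.exists_locallyIntegrable (fun x r hr => (hμ x r hr).2.ne)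
    ENNReal.ofReal_ne_top hdoub hK hbdd
  refine ⟨f, hf, fun x r hr =>
    hΛ.setIntegral_abs_sub_average_le hK hfm hfΛ x hr (hμ x r hr).2.ne, fun φ hφ => ?_⟩
  let Φ : C_c(M, ℝ) := ⟨⟨φ, hφ.1⟩, hφ.2.1⟩
  exact (hext Φ hφ.2.2).symm.trans (hfΛ Φ).symm
end

section
/- Let M be locally compact and μ doubling with μ(M) = ∞. Then there exists a constant C such that ‖f‖_{H¹} ≤ ‖f‖_{F^C_c} ≤ C·‖f‖_{H¹} for every f that is a finite linear combination of continuous compactly supported (1,∞)-atoms. Equivalently: for every such f, every countable decomposition f = Σ_{k=1}^∞ λ_k a_k in L¹(μ) with (1,∞)-atoms a_k and Σ|λ_k| < ∞, there are N ∈ ℕ, scalars c_1,…,c_N, and continuous compactly supported (1,∞)-atoms b_1,…,b_N with f = Σ_{j=1}^N c_j b_j and Σ_{j=1}^N |c_j| ≤ C·Σ_{k=1}^∞ |λ_k|. -/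
open MeasureTheory Metric Filter

/-- A continuous compactly supported `(1,∞)`-atom. -/
def IsContCptAtom {M : Type*} [MetricSpace M] [MeasurableSpace M]
    (μ : MeasureTheory.Measure M) (a : M → ℝ) : Prop :=
  IsOneInfAtom μ a ∧ Continuous a ∧ HasCompactSupport a

theorem Set.finite_of_forall_finset_card_le {α : Type*} {t : Set α} {c : ℝ}
    (h : ∀ s : Finset α, ↑s ⊆ t → (s.card : ℝ) ≤ c) : t.Finite := by
  by_contra hinf
  obtain ⟨s, hs, hcard⟩ := Set.Infinite.exists_subset_card_eq hinf (⌊c⌋₊ + 1)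
  have := h s hs
  rw [hcard] at this
  push_cast at this
  linarith [Nat.lt_floor_add_one c]

section TruncatedCone

variable {M : Type*} [MetricSpace M]

/-- The truncated cone equal to `1` on `closedBall x (5 * r)` and to `0` off `ball x (6 * r)`. -/
noncomputable def truncatedCone (x : M) (r : ℝ) (y : M) : ℝ := max 0 (min 1 (6 - dist y x / r))

theorem continuous_truncatedCone (x : M) (r : ℝ) : Continuous (truncatedCone x r) := by
  unfold truncatedCone
  fun_prop

theorem truncatedCone_nonneg (x : M) (r : ℝ) (y : M) : 0 ≤ truncatedCone x r y :=
  le_max_left _ _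

theorem truncatedCone_le_one (x : M) (r : ℝ) (y : M) : truncatedCone x r y ≤ 1 :=
  max_le zero_le_one (min_le_left _ _)

theorem truncatedCone_eq_one {x y : M} {r : ℝ} (hr : 0 < r) (h : dist y x ≤ 5 * r) :
    truncatedCone x r y = 1 := by
  have : dist y x / r ≤ 5 := by rwa [div_le_iff₀ hr]
  rw [truncatedCone, min_eq_left (by linarith), max_eq_right zero_le_one]

theorem support_truncatedCone_subset (x : M) {r : ℝ} (hr : 0 < r) :
    Function.support (truncatedCone x r) ⊆ ball x (6 * r) := by
  intro y hy
  by_contra h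
  rw [mem_ball, not_lt] at h
  have : 6 ≤ dist y x / r := by rwa [le_div_iff₀ hr]
  exact hy (max_eq_left ((min_le_right _ _).trans (by linarith)))

end TruncatedCone

section Doubling

variable {M : Type*} [MetricSpace M] [MeasurableSpace M]

/-- A measure whose balls have positive finite measure and which is doubling with constant `D`. -/
structure IsDoublingWith (μ : Measure M) (D : ℝ) : Prop where
  one_le : 1 ≤ D
  pos : ∀ (x : M) (r : ℝ), 0 < r → 0 < μ.real (ball x r)
  lt_top : ∀ (x : M) (r : ℝ), μ (ball x r) < ⊤
  two_mul : ∀ (x : M) (r : ℝ), 0 < r → μ.real (ball x (2 * r)) ≤ D * μ.real (ball x r)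

namespace IsDoublingWith

variable {μ : Measure M} {D : ℝ}

theorem two_pow_mul (h : IsDoublingWith μ D) (n : ℕ) (x : M) {r : ℝ} (hr : 0 < r) :
    μ.real (ball x (2 ^ n * r)) ≤ D ^ n * μ.real (ball x r) := by
  have hD := h.one_le
  induction n with
  | zero => simp
  | succ n ih =>
    have h1 := h.two_mul x (2 ^ n * r) (by positivity)
    calc μ.real (ball x (2 ^ (n + 1) * r)) = μ.real (ball x (2 * (2 ^ n * r))) := by
          congr 2; ring
      _ ≤ D * μ.real (ball x (2 ^ n * r)) := h1
      _ ≤ D * (D ^ n * μ.real (ball x r)) := by gcongr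
      _ = D ^ (n + 1) * μ.real (ball x r) := by ring

theorem real_mono (h : IsDoublingWith μ D) {s : Set M} {x : M} {r : ℝ} (hs : s ⊆ ball x r) :
    μ.real s ≤ μ.real (ball x r) :=
  measureReal_mono hs (h.lt_top x r).ne

theorem real_le_of_subset (h : IsDoublingWith μ D) (n : ℕ) {s : Set M} {x : M} {r : ℝ}
    (hr : 0 < r) (hs : s ⊆ ball x (2 ^ n * r)) : μ.real s ≤ D ^ n * μ.real (ball x r) :=
  (h.real_mono hs).trans (h.two_pow_mul n x hr)

end IsDoublingWith

/-- A continuous, locally finite partition of unity subordinate to balls of radius at most `ε`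
whose radii vary slowly and whose members carry a fixed proportion of the mass of their ball. -/
structure AdaptedPartition (μ : Measure M) (C ε : ℝ) (ι : Type*) where
  /-- The functions of the partition. -/
  fn : ι → M → ℝ
  /-- The centers of the balls. -/
  center : ι → M
  /-- The radii of the balls. -/
  radius : ι → ℝ
  continuous : ∀ i, Continuous (fn i)
  nonneg : ∀ i x, 0 ≤ fn i x
  hasCompactSupport : ∀ i, HasCompactSupport (fn i)
  support_subset : ∀ i, Function.support (fn i) ⊆ ball (center i) (radius i)
  radius_pos : ∀ i, 0 < radius i
  radius_le : ∀ i, radius i ≤ ε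
  locallyFinite : LocallyFinite fun i => Function.support (fn i)
  sum_eq_one : ∀ x, ∑ᶠ i, fn i x = 1
  measure_le : ∀ i, μ.real (ball (center i) (radius i)) ≤ C * ∫ x, fn i x ∂μ
  comparable : ∀ i j x r, 0 < r → (Function.support (fn i) ∩ ball x r).Nonempty →
    (Function.support (fn j) ∩ ball x r).Nonempty → radius i ≤ 5 * max r (radius j)

theorem exists_slowly_varying_scale (M : Type*) [MetricSpace M] [LocallyCompactSpace M]
    {ε : ℝ} (hε : 0 < ε) :
    ∃ ρ : M → ℝ, (∀ x, 0 < ρ x) ∧ (∀ x, ρ x ≤ ε) ∧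
      (∀ x y, ρ x ≤ ρ y + dist x y / 12) ∧ ∀ x, IsCompact (closedBall x (6 * ρ x)) := by
  let S : M → Set ℝ := fun x => {t | 0 ≤ t ∧ t ≤ 12 * ε ∧ IsCompact (closedBall x t)}
  have hbdd : ∀ x, BddAbove (S x) := fun x => ⟨12 * ε, fun t ht => ht.2.1⟩
  have hzero : ∀ x, (0 : ℝ) ∈ S x := fun x => ⟨le_rfl, by positivity, by simp⟩
  have hpos : ∀ x, 0 < sSup (S x) := by
    intro x
    obtain ⟨r, hr, hc⟩ := exists_isCompact_closedBall x
    have hmin : 0 < min r (12 * ε) := by positivity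
    refine hmin.trans_le (le_csSup (hbdd x) ⟨hmin.le, min_le_right _ _, ?_⟩)
    exact hc.of_isClosed_subset isClosed_closedBall (closedBall_subset_closedBall (min_le_left _ _))
  refine ⟨fun x => sSup (S x) / 12, fun x => by have := hpos x; positivity, fun x => ?_,
    fun x y => ?_, fun x => ?_⟩
  · have : sSup (S x) ≤ 12 * ε := csSup_le ⟨0, hzero x⟩ fun t ht => ht.2.1
    linarith
  · have : sSup (S x) ≤ sSup (S y) + dist x y := by
      refine csSup_le ⟨0, hzero x⟩ fun t ht => ?_
      rcases le_total t (dist x y) with h | h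
      · linarith [hpos y]
      · have : t - dist x y ∈ S y := by
          refine ⟨by linarith, by linarith [ht.2.1, dist_nonneg (x := x) (y := y)], ?_⟩
          refine ht.2.2.of_isClosed_subset isClosed_closedBall (closedBall_subset_closedBall' ?_)
          rw [dist_comm y x]; linarith
        linarith [le_csSup (hbdd y) this]
    linarith
  · obtain ⟨t, ht, hlt⟩ := exists_lt_of_lt_csSup ⟨0, hzero x⟩
      (show sSup (S x) / 2 < sSup (S x) by linarith [hpos x])
    refine ht.2.2.of_isClosed_subset isClosed_closedBall (closedBall_subset_closedBall ?_)
    linarith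

theorem Finset.card_mul_le_of_pairwiseDisjoint [BorelSpace M] {μ : Measure M} {D : ℝ}
    (hμ : IsDoublingWith μ D) {ρ : M → ℝ} (hρ : ∀ x, 0 < ρ x) {u : Set M}
    (hu : u.PairwiseDisjoint fun x => closedBall x (ρ x)) (n : ℕ) {y : M} {R : ℝ} (hR : 0 < R)
    (s : Finset M) (hs : ↑s ⊆ u) (hsub : ∀ x ∈ s, closedBall x (ρ x) ⊆ ball y R)
    (hsup : ∀ x ∈ s, ball y R ⊆ ball x (2 ^ n * ρ x)) : (s.card : ℝ) ≤ D ^ n := by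
  have hD : 0 < D := by linarith [hμ.one_le]
  have hBpos := hμ.pos y R hR
  have h1 : ∑ x ∈ s, μ.real (closedBall x (ρ x)) ≤ μ.real (ball y R) := by
    rw [← measureReal_biUnion_finset (fun a ha b hb hab => hu (hs ha) (hs hb) hab)
      (fun x _ => measurableSet_closedBall)
      (fun x hx => ((measure_mono (hsub x hx)).trans_lt (hμ.lt_top _ _)).ne)]
    exact hμ.real_mono (Set.iUnion₂_subset hsub)
  have h2 : ∀ x ∈ s, μ.real (ball y R) / D ^ n ≤ μ.real (closedBall x (ρ x)) := by
    intro x hx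
    rw [div_le_iff₀ (by positivity), mul_comm]
    refine (hμ.real_le_of_subset n (hρ x) (hsup x hx)).trans ?_
    gcongr
    · exact ((measure_mono (hsub x hx)).trans_lt (hμ.lt_top _ _)).ne
    · exact ball_subset_closedBall
  have h3 := (Finset.card_nsmul_le_sum _ _ _ h2).trans h1
  rw [nsmul_eq_mul, mul_div_assoc', div_le_iff₀ (by positivity), mul_comm] at h3
  exact le_of_mul_le_mul_left h3 hBpos

theorem IsDoublingWith.isLocallyFiniteMeasure {μ : Measure M} {D : ℝ} (h : IsDoublingWith μ D) :
    IsLocallyFiniteMeasure μ :=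
  ⟨fun x => ⟨ball x 1, ball_mem_nhds x one_pos, h.lt_top x 1⟩⟩

theorem IsDoublingWith.sigmaFinite [Nonempty M] {μ : Measure M} {D : ℝ}
    (h : IsDoublingWith μ D) : SigmaFinite μ :=
  ⟨⟨{ set := fun n : ℕ => ball (Classical.arbitrary M) n
      set_mem := fun _ => trivial
      finite := fun _ => h.lt_top _ _
      spanning := iUnion_ball_nat _ }⟩⟩

theorem exists_adaptedPartition [BorelSpace M] [LocallyCompactSpace M] [Nonempty M]
    {μ : Measure M} {D : ℝ} (hμ : IsDoublingWith μ D) {ε : ℝ} (hε : 0 < ε) :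
    ∃ u : Set M, u.Countable ∧ Nonempty (AdaptedPartition μ (D ^ 9) ε u) := by
  have hD := hμ.one_le
  have := hμ.isLocallyFiniteMeasure
  have := hμ.sigmaFinite
  obtain ⟨ρ, hpos, hle, hlip, hcpt⟩ := exists_slowly_varying_scale M (ε := ε / 6) (by positivity)
  obtain ⟨u, -, hdisj, hcov⟩ := Vitali.exists_disjoint_subfamily_covering_enlargement_closedBall
    Set.univ (fun x : M => x) ρ (ε / 6) (fun x _ => hle x) 5 (by norm_num)
  have hcount : ∀ y, ∀ s : Finset M,
      ↑s ⊆ {x ∈ u | (ball x (6 * ρ x) ∩ ball y (ρ y)).Nonempty} → (s.card : ℝ) ≤ D ^ 6 := by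
    intro y s hs
    have key : ∀ x ∈ s, dist x y < 6 * ρ x + ρ y ∧ ρ x ≤ 13 / 6 * ρ y ∧ ρ y ≤ 18 / 11 * ρ x := by
      intro x hx
      obtain ⟨z, hz, hz'⟩ := (hs hx).2
      have h1 : dist x y < 6 * ρ x + ρ y := by
        rw [mem_ball] at hz hz'
        linarith [dist_triangle_left x y z]
      have h2 := hlip x y
      have h3 := hlip y x
      rw [dist_comm y x] at h3
      exact ⟨h1, by linarith, by linarith⟩
    refine Finset.card_mul_le_of_pairwiseDisjoint hμ hpos hdisj 6 (y := y) (R := 17 * ρ y)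
      (by have := hpos y; positivity) s (fun x hx => (hs hx).1) (fun x hx => ?_) (fun x hx => ?_)
    · obtain ⟨h1, h2, h3⟩ := key x hx
      refine closedBall_subset_ball' ?_
      linarith [hpos y]
    · obtain ⟨h1, h2, h3⟩ := key x hx
      refine ball_subset_ball' ?_
      rw [dist_comm y x]
      linarith [hpos y, hpos x]
  have hfin : ∀ y, {i : u | (ball i.1 (6 * ρ i) ∩ ball y (ρ y)).Nonempty}.Finite := by
    intro y
    have := Set.finite_of_forall_finset_card_le (hcount y)
    refine (this.preimage (Subtype.val_injective.injOn)).subset ?_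
    intro i hi
    exact ⟨i.2, hi⟩
  let χ : u → M → ℝ := fun i => truncatedCone i.1 (ρ i)
  have hsupp : ∀ i, Function.support (χ i) ⊆ ball i.1 (6 * ρ i) := fun i =>
    support_truncatedCone_subset _ (hpos _)
  have hlf : LocallyFinite fun i => Function.support (χ i) := fun y =>
    ⟨ball y (ρ y), ball_mem_nhds _ (hpos y),
      (hfin y).subset fun i hi => hi.mono (Set.inter_subset_inter_left _ (hsupp i))⟩
  have hpt : ∀ y, (Function.support fun i => χ i y).Finite := fun y => hlf.point_finite y
  let σ : M → ℝ := fun y => ∑ᶠ i, χ i y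
  have hσc : Continuous σ := continuous_finsum (fun i => continuous_truncatedCone _ _) hlf
  have hσ1 : ∀ y, 1 ≤ σ y := by
    intro y
    obtain ⟨x, hx, hsub⟩ := hcov y trivial
    have h1 : χ ⟨x, hx⟩ y = 1 :=
      truncatedCone_eq_one (hpos x) (hsub (mem_closedBall_self (hpos y).le))
    rw [← h1]
    exact single_le_finsum _ (hpt y) fun i => truncatedCone_nonneg _ _ _
  have hσ2 : ∀ y, σ y ≤ D ^ 6 := by
    intro y
    refine le_trans ?_ (hcount y ((hpt y).toFinset.map (Function.Embedding.subtype _)) ?_)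
    · rw [Finset.card_map]
      simp only [σ]
      rw [finsum_eq_sum _ (hpt y)]
      refine (Finset.sum_le_card_nsmul _ _ 1 fun i _ => truncatedCone_le_one _ _ _).trans ?_
      simp
    · intro x hx
      simp only [Finset.coe_map, Set.mem_image, Finset.mem_coe, Set.Finite.mem_toFinset] at hx
      obtain ⟨i, hi, rfl⟩ := hx
      exact ⟨i.2, y, hsupp i hi, mem_ball_self (hpos y)⟩
  have hψsupp : ∀ i, (Function.support fun y => χ i y / σ y) ⊆ Function.support (χ i) := by
    intro i y hy h
    exact hy (by simp [show χ i y = 0 from h])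
  have hψc : ∀ i, Continuous fun y => χ i y / σ y := fun i =>
    (continuous_truncatedCone _ _).div hσc fun y => by linarith [hσ1 y]
  have hψnonneg : ∀ i y, 0 ≤ χ i y / σ y := fun i y =>
    div_nonneg (truncatedCone_nonneg _ _ _) (by linarith [hσ1 y])
  have hψcpt : ∀ i, HasCompactSupport fun y => χ i y / σ y := fun i =>
    HasCompactSupport.of_support_subset_isCompact (hcpt i)
      ((hψsupp i).trans ((hsupp i).trans ball_subset_closedBall))
  refine ⟨u, ?_, ⟨{
    fn := fun i y => χ i y / σ y
    center := fun i => i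
    radius := fun i => 6 * ρ i
    continuous := hψc
    nonneg := hψnonneg
    hasCompactSupport := hψcpt
    support_subset := fun i => (hψsupp i).trans (hsupp i)
    radius_pos := fun i => by have := hpos i; positivity
    radius_le := fun i => by linarith [hle i]
    locallyFinite := hlf.subset hψsupp
    sum_eq_one := fun y => by
      simp only [div_eq_mul_inv]
      rw [← finsum_mul]
      exact mul_inv_cancel₀ (by linarith [hσ1 y])
    measure_le := fun i => ?_
    comparable := fun i j x r hr hi hj => ?_ }⟩⟩
  · have h := Measure.countable_meas_pos_of_disjoint_iUnion (μ := μ)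
      (As := fun i : u => closedBall i.1 (ρ i)) (fun i => measurableSet_closedBall)
      (fun i j hij => hdisj i.2 j.2 (fun h => hij (Subtype.ext h)))
    rw [← Set.countable_coe_iff, ← Set.countable_univ_iff]
    refine h.mono fun i _ => ?_
    have h1 := hμ.pos i.1 (ρ i) (hpos i)
    rw [measureReal_def, ENNReal.toReal_pos_iff] at h1
    exact h1.1.trans_le (measure_mono ball_subset_closedBall)
  · have h1 : μ.real (ball i.1 (6 * ρ i)) ≤ D ^ 3 * μ.real (ball i.1 (ρ i)) :=
      hμ.real_le_of_subset 3 (hpos i) (ball_subset_ball (by linarith [hpos i]))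
    have h2 : (D ^ 6)⁻¹ * μ.real (ball i.1 (ρ i)) ≤ ∫ y, χ i y / σ y ∂μ := by
      rw [mul_comm, ← smul_eq_mul, ← integral_indicator_const _ measurableSet_ball]
      refine integral_mono ?_ ((hψc i).integrable_of_hasCompactSupport (hψcpt i)) fun y => ?_
      · exact (integrable_indicator_iff measurableSet_ball).2
          (integrableOn_const (hμ.lt_top _ _).ne)
      · by_cases hy : y ∈ ball i.1 (ρ i)
        · have : χ i y = 1 := truncatedCone_eq_one (hpos i)
            (by rw [mem_ball] at hy; linarith [hpos i])
          simp only [Set.indicator_of_mem hy, this, one_div]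
          exact inv_anti₀ (by linarith [hσ1 y]) (hσ2 y)
        · rw [Set.indicator_of_notMem hy]
          exact hψnonneg i y
    calc μ.real (ball i.1 (6 * ρ i)) ≤ D ^ 3 * μ.real (ball i.1 (ρ i)) := h1
      _ = D ^ 9 * ((D ^ 6)⁻¹ * μ.real (ball i.1 (ρ i))) := by
          have : D ≠ 0 := by linarith
          field_simp
      _ ≤ _ := by gcongr
  · obtain ⟨z, hz, hzx⟩ := hi
    obtain ⟨w, hw, hwx⟩ := hj
    have hz := hsupp i (hψsupp i hz)
    have hw := hsupp j (hψsupp j hw)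
    rw [mem_ball] at hz hzx hw hwx
    have h1 : dist i.1 j.1 < 6 * ρ i + r + r + 6 * ρ j := by
      have := dist_triangle4 i.1 z w j.1
      have := dist_triangle_right z w x
      rw [dist_comm i.1 z] at *
      linarith
    have h2 := hlip i j
    rcases le_total r (6 * ρ j) with h | h
    · rw [max_eq_right h]; linarith
    · rw [max_eq_left h]; linarith

theorem AdaptedPartition.sigmaCompactSpace {μ : Measure M} {C ε : ℝ} {ι : Type*} [Countable ι]
    (P : AdaptedPartition μ C ε ι) : SigmaCompactSpace M := by
  rw [← isSigmaCompact_univ_iff]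
  have : (⋃ i, tsupport (P.fn i)) = Set.univ := by
    refine Set.eq_univ_of_forall fun x => ?_
    by_contra h
    rw [Set.mem_iUnion, not_exists] at h
    have h0 : ∀ i, P.fn i x = 0 := fun i => image_eq_zero_of_notMem_tsupport (h i)
    have := P.sum_eq_one x
    simp [h0] at this
  rw [← this]
  exact isSigmaCompact_iUnion_of_isCompact _ fun i => P.hasCompactSupport i

/-- The space of continuous compactly supported real functions. -/
def compactlySupportedSubmodule (M : Type*) [TopologicalSpace M] : Submodule ℝ (M → ℝ) where
  carrier := {h | Continuous h ∧ HasCompactSupport h}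
  zero_mem' := ⟨continuous_zero, HasCompactSupport.zero⟩
  add_mem' := fun hf hg => ⟨hf.1.add hg.1, hf.2.add hg.2⟩
  smul_mem' := fun c _ hf => ⟨hf.1.const_smul c, hf.2.smul_left (f := fun _ => c)⟩

/-- A linear functional which on mean zero continuous functions supported in a ball `B` is
bounded by `μ B` times the supremum norm. -/
def IsAtomBounded (μ : Measure M) (G : (M → ℝ) →ₗ[ℝ] ℝ) : Prop :=
  ∀ h ∈ compactlySupportedSubmodule M, ∫ y, h y ∂μ = 0 → ∀ (x : M) (r A : ℝ), 0 < r →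
    (∀ y, y ∉ ball x r → h y = 0) → (∀ y, |h y| ≤ A) → |G h| ≤ A * μ.real (ball x r)

namespace AdaptedPartition

variable {μ : Measure M} {C ε D : ℝ} {ι : Type*} (P : AdaptedPartition μ C ε ι)

theorem fn_mem (i : ι) : P.fn i ∈ compactlySupportedSubmodule M :=
  ⟨P.continuous i, P.hasCompactSupport i⟩

theorem finite_support_apply (x : M) : (Function.support fun i => P.fn i x).Finite :=
  P.locallyFinite.point_finite x

theorem fn_le_one (i : ι) (x : M) : P.fn i x ≤ 1 := by
  rw [← P.sum_eq_one x]
  exact single_le_finsum i (P.finite_support_apply x) fun j => P.nonneg j x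

theorem abs_fn_le_one (i : ι) (x : M) : |P.fn i x| ≤ 1 := by
  rw [abs_of_nonneg (P.nonneg i x)]
  exact P.fn_le_one i x

theorem sum_fn_le_one (S : Finset ι) (x : M) : ∑ i ∈ S, P.fn i x ≤ 1 := by
  classical
  rw [← P.sum_eq_one x, finsum_eq_sum_of_support_subset
    (s := S ∪ (P.finite_support_apply x).toFinset) _ (by simp)]
  exact Finset.sum_le_sum_of_subset_of_nonneg Finset.subset_union_left
    fun i _ _ => P.nonneg i x

/-- The total mass of a member of the partition. -/
noncomputable def weight (i : ι) : ℝ := ∫ x, P.fn i x ∂μ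

theorem weight_pos (hμ : IsDoublingWith μ D) (i : ι) : 0 < P.weight i := by
  have h0 : 0 ≤ P.weight i := integral_nonneg (P.nonneg i)
  refine h0.lt_of_ne fun h => ?_
  have h1 := P.measure_le i
  rw [show ∫ x, P.fn i x ∂μ = 0 from h.symm, mul_zero] at h1
  exact absurd (hμ.pos _ _ (P.radius_pos i)) (not_lt.2 h1)

theorem support_subset_of_sum {c : ι → ℝ} {S : Finset ι} {E : Set M}
    (hS : ∀ i, (Function.support (P.fn i) ∩ E).Nonempty → i ∈ S) {x : M} (hx : x ∈ E) :
    (Function.support fun i => c i * P.fn i x) ⊆ S := by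
  intro i hi
  exact hS i ⟨x, right_ne_zero_of_mul hi, hx⟩

/-- The function attached to a linear functional `G` by averaging it against the partition. -/
noncomputable def symbol (G : (M → ℝ) →ₗ[ℝ] ℝ) (x : M) : ℝ :=
  ∑ᶠ i, G (P.fn i) / P.weight i * P.fn i x

theorem continuous_symbol (G : (M → ℝ) →ₗ[ℝ] ℝ) : Continuous (P.symbol G) :=
  continuous_finsum (fun i => continuous_const.mul (P.continuous i))
    (P.locallyFinite.subset fun _ _ hx => right_ne_zero_of_mul hx)

theorem symbol_eq_sum (G : (M → ℝ) →ₗ[ℝ] ℝ) {S : Finset ι} {E : Set M}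
    (hS : ∀ i, (Function.support (P.fn i) ∩ E).Nonempty → i ∈ S) {x : M} (hx : x ∈ E) :
    P.symbol G x = ∑ i ∈ S, G (P.fn i) / P.weight i * P.fn i x :=
  finsum_eq_sum_of_support_subset _ (P.support_subset_of_sum hS hx)

theorem sum_fn_eq_one {S : Finset ι} {E : Set M}
    (hS : ∀ i, (Function.support (P.fn i) ∩ E).Nonempty → i ∈ S) {x : M} (hx : x ∈ E) :
    ∑ i ∈ S, P.fn i x = 1 := by
  rw [← P.sum_eq_one x, finsum_eq_sum_of_support_subset]
  simpa using P.support_subset_of_sum (c := fun _ => 1) hS hx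

/-- The averages of `h` against the members of the partition in `S`. -/
noncomputable def average (h : M → ℝ) (S : Finset ι) : M → ℝ :=
  ∑ i ∈ S, ((∫ y, P.fn i y * h y ∂μ) / P.weight i) • P.fn i

theorem average_mem (h : M → ℝ) (S : Finset ι) :
    P.average h S ∈ compactlySupportedSubmodule M :=
  Submodule.sum_mem _ fun i _ => Submodule.smul_mem _ _ (P.fn_mem i)

theorem average_apply (h : M → ℝ) (S : Finset ι) (x : M) :
    P.average h S x = ∑ i ∈ S, (∫ y, P.fn i y * h y ∂μ) / P.weight i * P.fn i x := by
  simp [average, Finset.sum_apply]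

theorem finite_support_inter_nonempty {L : Set M} (hL : IsCompact L) :
    {i | (Function.support (P.fn i) ∩ L).Nonempty}.Finite :=
  P.locallyFinite.finite_nonempty_inter_compact hL

theorem average_eq_zero {h : M → ℝ} {S : Finset ι} {x : M} (hx : ∀ i ∈ S, P.fn i x = 0) :
    P.average h S x = 0 := by
  rw [average_apply]
  exact Finset.sum_eq_zero fun i hi => by rw [hx i hi, mul_zero]

variable [BorelSpace M]

theorem integrable_fn_mul {h : M → ℝ} (hh : Integrable h μ) (i : ι) :
    Integrable (fun y => P.fn i y * h y) μ :=
  hh.bdd_mul (c := 1) (P.continuous i).measurable.aestronglyMeasurable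
    (Eventually.of_forall (P.abs_fn_le_one i))

theorem integral_symbol_mul (G : (M → ℝ) →ₗ[ℝ] ℝ) {h : M → ℝ} (hh : Integrable h μ)
    {S : Finset ι} {E : Set M} (hS : ∀ i, (Function.support (P.fn i) ∩ E).Nonempty → i ∈ S)
    (hE : ∀ y, y ∉ E → h y = 0) :
    ∫ y, P.symbol G y * h y ∂μ =
      ∑ i ∈ S, G (P.fn i) / P.weight i * ∫ y, P.fn i y * h y ∂μ := by
  have : ∀ y, P.symbol G y * h y =
      ∑ i ∈ S, G (P.fn i) / P.weight i * (P.fn i y * h y) := by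
    intro y
    by_cases hy : y ∈ E
    · rw [P.symbol_eq_sum G hS hy, Finset.sum_mul]
      simp only [mul_assoc]
    · simp [hE y hy]
  simp_rw [this]
  rw [integral_finsetSum _ fun i _ => (P.integrable_fn_mul hh i).const_mul _]
  simp_rw [integral_const_mul]

theorem sum_integral_fn_mul {h : M → ℝ} (hh : Integrable h μ)
    {S : Finset ι} {E : Set M} (hS : ∀ i, (Function.support (P.fn i) ∩ E).Nonempty → i ∈ S)
    (hE : ∀ y, y ∉ E → h y = 0) :
    ∑ i ∈ S, ∫ y, P.fn i y * h y ∂μ = ∫ y, h y ∂μ := by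
  rw [← integral_finsetSum _ fun i _ => P.integrable_fn_mul hh i]
  refine integral_congr_ae (Eventually.of_forall fun y => ?_)
  by_cases hy : y ∈ E
  · simp only
    rw [← Finset.sum_mul, P.sum_fn_eq_one hS hy, one_mul]
  · simp [hE y hy]

theorem sum_abs_integral_fn_mul_le {h : M → ℝ} (hh : Integrable h μ) (S : Finset ι) :
    ∑ i ∈ S, |∫ y, P.fn i y * h y ∂μ| ≤ ∫ y, |h y| ∂μ := by
  calc ∑ i ∈ S, |∫ y, P.fn i y * h y ∂μ| ≤ ∑ i ∈ S, ∫ y, P.fn i y * |h y| ∂μ := by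
        refine Finset.sum_le_sum fun i _ => abs_integral_le_integral_abs.trans_eq ?_
        simp only [abs_mul, abs_of_nonneg (P.nonneg i _)]
    _ = ∫ y, ∑ i ∈ S, P.fn i y * |h y| ∂μ :=
        (integral_finsetSum _ fun i _ => P.integrable_fn_mul hh.abs i).symm
    _ ≤ ∫ y, |h y| ∂μ := by
        refine integral_mono (integrable_finsetSum _ fun i _ => P.integrable_fn_mul hh.abs i)
          hh.abs fun y => ?_
        simp only
        rw [← Finset.sum_mul]
        exact mul_le_of_le_one_left (abs_nonneg _) (P.sum_fn_le_one S y)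

theorem apply_average (G : (M → ℝ) →ₗ[ℝ] ℝ) {h : M → ℝ} (hh : Integrable h μ)
    {S : Finset ι} {E : Set M} (hS : ∀ i, (Function.support (P.fn i) ∩ E).Nonempty → i ∈ S)
    (hE : ∀ y, y ∉ E → h y = 0) : G (P.average h S) = ∫ y, P.symbol G y * h y ∂μ := by
  rw [P.integral_symbol_mul G hh hS hE, average, map_sum]
  refine Finset.sum_congr rfl fun i _ => ?_
  rw [map_smul, smul_eq_mul]
  ring

variable [IsLocallyFiniteMeasure μ]

theorem integrable_fn (i : ι) : Integrable (P.fn i) μ :=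
  (P.continuous i).integrable_of_hasCompactSupport (P.hasCompactSupport i)

theorem integral_average (hμ : IsDoublingWith μ D) {h : M → ℝ} (hh : Integrable h μ)
    {S : Finset ι} {E : Set M} (hS : ∀ i, (Function.support (P.fn i) ∩ E).Nonempty → i ∈ S)
    (hE : ∀ y, y ∉ E → h y = 0) : ∫ y, P.average h S y ∂μ = ∫ y, h y ∂μ := by
  simp_rw [average_apply]
  rw [integral_finsetSum _ fun i _ => (P.integrable_fn i).const_mul _,
    ← P.sum_integral_fn_mul hh hS hE]
  refine Finset.sum_congr rfl fun i _ => ?_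
  rw [integral_const_mul]
  exact div_mul_cancel₀ _ (P.weight_pos hμ i).ne'

theorem abs_integral_fn_mul_le {h : M → ℝ} {H : ℝ} (hH : ∀ y, |h y| ≤ H) (i : ι) :
    |∫ y, P.fn i y * h y ∂μ| ≤ H * P.weight i := by
  rw [weight, ← integral_const_mul, ← Real.norm_eq_abs]
  refine norm_integral_le_of_norm_le ((P.integrable_fn i).const_mul H)
    (Eventually.of_forall fun y => ?_)
  rw [Real.norm_eq_abs, abs_mul, abs_of_nonneg (P.nonneg i y), mul_comm]
  exact mul_le_mul_of_nonneg_right (hH y) (P.nonneg i y)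

theorem abs_average_le (hμ : IsDoublingWith μ D) {h : M → ℝ} {H : ℝ} (hH : ∀ y, |h y| ≤ H)
    (S : Finset ι) (x : M) : |P.average h S x| ≤ H := by
  have hH0 : 0 ≤ H := (abs_nonneg _).trans (hH x)
  rw [average_apply]
  calc |∑ i ∈ S, (∫ y, P.fn i y * h y ∂μ) / P.weight i * P.fn i x|
      ≤ ∑ i ∈ S, |(∫ y, P.fn i y * h y ∂μ) / P.weight i * P.fn i x| :=
        Finset.abs_sum_le_sum_abs _ _
    _ ≤ ∑ i ∈ S, H * P.fn i x := by
        refine Finset.sum_le_sum fun i _ => ?_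
        rw [abs_mul, abs_of_nonneg (P.nonneg i x), abs_div, abs_of_pos (P.weight_pos hμ i)]
        refine mul_le_mul_of_nonneg_right ?_ (P.nonneg i x)
        rw [div_le_iff₀ (P.weight_pos hμ i)]
        exact P.abs_integral_fn_mul_le hH i
    _ = H * ∑ i ∈ S, P.fn i x := (Finset.mul_sum _ _ _).symm
    _ ≤ H := mul_le_of_le_one_right hH0 (P.sum_fn_le_one S x)

theorem abs_apply_sub_apply_le (hμ : IsDoublingWith μ D) {G : (M → ℝ) →ₗ[ℝ] ℝ}
    (hG : IsAtomBounded μ G) {i j : ι}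
    (hij : P.radius i ≤ 5 * P.radius j) (hji : P.radius j ≤ 5 * P.radius i)
    (hd : dist (P.center i) (P.center j) ≤ 2 * P.radius i + P.radius j) :
    |G (P.fn j) / P.weight j - G (P.fn i) / P.weight i| ≤ 2 * C * D ^ 7 := by
  have hD := hμ.one_le
  have hi := P.weight_pos hμ i
  have hj := P.weight_pos hμ j
  have hri := P.radius_pos i
  have hrj := P.radius_pos j
  set k : M → ℝ := (P.weight j)⁻¹ • P.fn j - (P.weight i)⁻¹ • P.fn i with hk
  have hkG : G (P.fn j) / P.weight j - G (P.fn i) / P.weight i = G k := by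
    rw [hk, map_sub, map_smul, map_smul, smul_eq_mul, smul_eq_mul]
    ring
  have hkmem : k ∈ compactlySupportedSubmodule M :=
    Submodule.sub_mem _ (Submodule.smul_mem _ _ (P.fn_mem j)) (Submodule.smul_mem _ _ (P.fn_mem i))
  have hkint : ∫ y, k y ∂μ = 0 := by
    simp only [hk, Pi.sub_apply, Pi.smul_apply, smul_eq_mul]
    rw [integral_sub ((P.integrable_fn j).const_mul _) ((P.integrable_fn i).const_mul _),
      integral_const_mul, integral_const_mul]
    change (P.weight j)⁻¹ * P.weight j - (P.weight i)⁻¹ * P.weight i = 0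
    rw [inv_mul_cancel₀ hi.ne', inv_mul_cancel₀ hj.ne', sub_self]
  have hksupp : ∀ y, y ∉ ball (P.center i) (16 * P.radius i) → k y = 0 := by
    intro y hy
    have h1 : P.fn i y = 0 := by
      by_contra h
      exact hy (ball_subset_ball (by linarith) (P.support_subset i h))
    have h2 : P.fn j y = 0 := by
      by_contra h
      refine hy (ball_subset_ball' ?_ (P.support_subset j h))
      rw [dist_comm]
      linarith
    simp [hk, h1, h2]
  have hkle : ∀ y, |k y| ≤ (P.weight j)⁻¹ + (P.weight i)⁻¹ := by
    intro y
    simp only [hk, Pi.sub_apply, Pi.smul_apply, smul_eq_mul]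
    refine (abs_sub _ _).trans ?_
    rw [abs_mul, abs_mul, abs_of_pos (inv_pos.2 hi), abs_of_pos (inv_pos.2 hj)]
    gcongr
    · exact mul_le_of_le_one_right (by positivity) (P.abs_fn_le_one _ _)
    · exact mul_le_of_le_one_right (by positivity) (P.abs_fn_le_one _ _)
  rw [hkG]
  refine (hG k hkmem hkint _ _ _ (by positivity) hksupp hkle).trans ?_
  have e1 : μ.real (ball (P.center i) (16 * P.radius i)) ≤ D ^ 7 * (C * P.weight i) := by
    refine (hμ.real_le_of_subset 7 hri (ball_subset_ball (by linarith))).trans ?_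
    gcongr
    exact P.measure_le i
  have e2 : μ.real (ball (P.center i) (16 * P.radius i)) ≤ D ^ 7 * (C * P.weight j) := by
    refine (hμ.real_le_of_subset 7 (x := P.center j) hrj (ball_subset_ball' ?_)).trans ?_
    · linarith
    · gcongr
      exact P.measure_le j
  calc ((P.weight j)⁻¹ + (P.weight i)⁻¹) * μ.real (ball (P.center i) (16 * P.radius i))
      = (P.weight j)⁻¹ * μ.real (ball (P.center i) (16 * P.radius i)) +
        (P.weight i)⁻¹ * μ.real (ball (P.center i) (16 * P.radius i)) := add_mul _ _ _
    _ ≤ (P.weight j)⁻¹ * (D ^ 7 * (C * P.weight j)) +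
        (P.weight i)⁻¹ * (D ^ 7 * (C * P.weight i)) := by gcongr
    _ = 2 * C * D ^ 7 := by field_simp; ring

theorem abs_integral_symbol_mul_le (hμ : IsDoublingWith μ D) {G : (M → ℝ) →ₗ[ℝ] ℝ}
    (hG : IsAtomBounded μ G) (hC : 1 ≤ C) {h : M → ℝ} {H : ℝ} {L : Set M} {x : M} {r : ℝ}
    (hr : 0 < r) (hL : IsCompact L) (hm : Measurable h) (hE : ∀ y, y ∉ L ∩ ball x r → h y = 0)
    (hH : ∀ y, |h y| ≤ H) (h0 : ∫ y, h y ∂μ = 0) :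
    |∫ y, P.symbol G y * h y ∂μ| ≤ 2 * C * D ^ 7 * (H * μ.real (ball x r)) := by
  have hD := hμ.one_le
  have hH0 : 0 ≤ H := (abs_nonneg _).trans (hH x)
  have hoff : ∀ y, y ∉ ball x r → h y = 0 := fun y hy => hE y fun h => hy h.2
  have hh : Integrable h μ := by
    have : IntegrableOn h (ball x r) μ :=
      Measure.integrableOn_of_bounded (hμ.lt_top x r).ne hm.aestronglyMeasurable
        (Eventually.of_forall hH)
    exact (integrableOn_iff_integrable_of_support_subset
      fun y hy => by_contra fun h => hy (hoff y h)).1 this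
  have hL1 : ∫ y, |h y| ∂μ ≤ H * μ.real (ball x r) := by
    rw [← setIntegral_eq_integral_of_forall_compl_eq_zero (s := ball x r)
      fun y hy => by rw [hoff y hy, abs_zero]]
    refine (le_abs_self _).trans ?_
    rw [← Real.norm_eq_abs]
    refine norm_setIntegral_le_of_norm_le_const (hμ.lt_top x r) fun y _ => ?_
    rw [Real.norm_eq_abs, abs_abs]
    exact hH y
  have hfin : {i | (Function.support (P.fn i) ∩ (L ∩ ball x r)).Nonempty}.Finite :=
    (P.finite_support_inter_nonempty hL).subset fun i hi =>
      hi.mono (Set.inter_subset_inter_right _ Set.inter_subset_left)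
  have hS : ∀ i, (Function.support (P.fn i) ∩ (L ∩ ball x r)).Nonempty → i ∈ hfin.toFinset :=
    fun i hi => hfin.mem_toFinset.2 hi
  have hS' : ∀ i ∈ hfin.toFinset, (Function.support (P.fn i) ∩ ball x r).Nonempty :=
    fun i hi => (hfin.mem_toFinset.1 hi).mono
      (Set.inter_subset_inter_right _ Set.inter_subset_right)
  by_cases hcase : ∀ i ∈ hfin.toFinset, P.radius i ≤ 5 * r
  · rw [← P.apply_average G hh hS hE]
    refine (hG _ (P.average_mem h _) ((P.integral_average hμ hh hS hE).trans h0) x (16 * r) H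
      (by positivity) (fun y hy => P.average_eq_zero fun i hi => ?_)
      (P.abs_average_le hμ hH _)).trans ?_
    · by_contra hne
      obtain ⟨z, hz, hzx⟩ := hS' i hi
      have h1 := P.support_subset i hne
      have h2 := P.support_subset i hz
      rw [mem_ball] at h1 h2 hzx hy
      have := hcase i hi
      have := dist_triangle4_left y x (P.center i) z
      have := dist_triangle y z x
      have := dist_triangle_right y z (P.center i)
      linarith
    · have h1 := hμ.real_le_of_subset 4 (s := ball x (16 * r)) hr
        (ball_subset_ball (by linarith))
      have h2 : D ^ 4 ≤ 2 * C * D ^ 7 := by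
        calc D ^ 4 ≤ D ^ 7 := pow_le_pow_right₀ hD (by norm_num)
          _ ≤ 2 * C * D ^ 7 := le_mul_of_one_le_left (by positivity) (by linarith)
      calc H * μ.real (ball x (16 * r)) ≤ H * (D ^ 4 * μ.real (ball x r)) := by gcongr
        _ ≤ H * (2 * C * D ^ 7 * μ.real (ball x r)) := by gcongr
        _ = _ := by ring
  · push Not at hcase
    obtain ⟨i, hi, hir⟩ := hcase
    have hpair : ∀ j ∈ hfin.toFinset,
        |G (P.fn j) / P.weight j - G (P.fn i) / P.weight i| ≤ 2 * C * D ^ 7 := by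
      intro j hj
      have h1 := P.comparable i j x r hr (hS' i hi) (hS' j hj)
      have h2 := P.comparable j i x r hr (hS' j hj) (hS' i hi)
      have hij : P.radius i ≤ 5 * P.radius j := by
        rcases le_total r (P.radius j) with h | h
        · rwa [max_eq_right h] at h1
        · rw [max_eq_left h] at h1; linarith
      rw [max_eq_right (by linarith)] at h2
      refine P.abs_apply_sub_apply_le hμ hG hij h2 ?_
      obtain ⟨z, hz, hzx⟩ := hS' i hi
      obtain ⟨w, hw, hwx⟩ := hS' j hj
      have hz := P.support_subset i hz
      have hw := P.support_subset j hw
      rw [mem_ball] at hz hw hzx hwx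
      have := dist_triangle4 (P.center i) z w (P.center j)
      have := dist_triangle_right z w x
      rw [dist_comm (P.center i) z] at *
      linarith
    have hsum : ∫ y, P.symbol G y * h y ∂μ = ∑ j ∈ hfin.toFinset,
        (G (P.fn j) / P.weight j - G (P.fn i) / P.weight i) * ∫ y, P.fn j y * h y ∂μ := by
      simp_rw [sub_mul]
      rw [Finset.sum_sub_distrib, ← Finset.mul_sum, P.sum_integral_fn_mul hh hS hE, h0, mul_zero,
        sub_zero, P.integral_symbol_mul G hh hS hE]
    rw [hsum]
    calc _ ≤ ∑ j ∈ hfin.toFinset, |(G (P.fn j) / P.weight j - G (P.fn i) / P.weight i) *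
          ∫ y, P.fn j y * h y ∂μ| := Finset.abs_sum_le_sum_abs _ _
      _ ≤ ∑ j ∈ hfin.toFinset, 2 * C * D ^ 7 * |∫ y, P.fn j y * h y ∂μ| := by
          refine Finset.sum_le_sum fun j hj => ?_
          rw [abs_mul]
          exact mul_le_mul_of_nonneg_right (hpair j hj) (abs_nonneg _)
      _ = 2 * C * D ^ 7 * ∑ j ∈ hfin.toFinset, |∫ y, P.fn j y * h y ∂μ| :=
          (Finset.mul_sum _ _ _).symm
      _ ≤ _ := by
          gcongr
          exact (P.sum_abs_integral_fn_mul_le hh _).trans hL1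

theorem exists_setIntegral_abs_symbol_sub_le (hμ : IsDoublingWith μ D) {G : (M → ℝ) →ₗ[ℝ] ℝ}
    (hG : IsAtomBounded μ G) (hC : 1 ≤ C) {L : Set M} (hL : IsCompact L) (x : M) {r : ℝ}
    (hr : 0 < r) :
    ∃ c, ∫ y in L ∩ ball x r, |P.symbol G y - c| ∂μ ≤ 4 * C * D ^ 7 * μ.real (ball x r) := by
  set g := P.symbol G with hg
  set E := L ∩ ball x r with hEdef
  have hE : MeasurableSet E := hL.measurableSet.inter measurableSet_ball
  have hEfin : μ E < ⊤ := (measure_mono Set.inter_subset_right).trans_lt (hμ.lt_top x r)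
  have hgm : Measurable g := (P.continuous_symbol G).measurable
  have hgE : IntegrableOn g E μ :=
    ((P.continuous_symbol G).continuousOn.integrableOn_compact hL).mono_set Set.inter_subset_left
  set c := (∫ y in E, g y ∂μ) / μ.real E with hc
  let σ : M → ℝ := fun y => if c ≤ g y then 1 else -1
  have hσm : Measurable σ :=
    Measurable.ite (measurableSet_le measurable_const hgm) measurable_const measurable_const
  have hσ1 : ∀ y, |σ y| ≤ 1 := by
    intro y
    simp only [σ]
    split_ifs <;> simp
  have hσE : IntegrableOn σ E μ :=
    Measure.integrableOn_of_bounded hEfin.ne hσm.aestronglyMeasurable (Eventually.of_forall hσ1)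
  set s := (∫ y in E, σ y ∂μ) / μ.real E with hs
  have hs1 : |s| ≤ 1 := by
    rw [hs, abs_div, abs_of_nonneg (measureReal_nonneg : 0 ≤ μ.real E)]
    refine div_le_one_of_le₀ ?_ measureReal_nonneg
    have := norm_setIntegral_le_of_norm_le_const (f := σ) (C := 1) hEfin fun y _ => hσ1 y
    rwa [one_mul] at this
  have hgσ : IntegrableOn (fun y => g y * σ y) E μ :=
    hgE.mul_bdd (c := 1) hσm.aestronglyMeasurable (Eventually.of_forall hσ1)
  let h : M → ℝ := E.indicator fun y => σ y - s
  have hsint : ∫ y in E, (σ y - s) ∂μ = 0 := by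
    rw [integral_sub hσE (integrableOn_const hEfin.ne), setIntegral_const, smul_eq_mul]
    rcases eq_or_ne (μ.real E) 0 with h0 | h0
    · have : μ E = 0 := (measureReal_eq_zero_iff hEfin.ne).1 h0
      rw [h0, setIntegral_measure_zero _ this]
      simp
    · rw [hs, mul_div_cancel₀ _ h0, sub_self]
  have key := P.abs_integral_symbol_mul_le hμ hG hC hr hL (h := h) (H := 2)
    ((hσm.sub_const s).indicator hE) (fun y hy => Set.indicator_of_notMem hy _)
    (fun y => ?_) ((integral_indicator hE).trans hsint)
  · refine ⟨c, ?_⟩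
    have e1 : ∫ y, g y * h y ∂μ = ∫ y in E, |g y - c| ∂μ := by
      have : (fun y => g y * h y) = E.indicator fun y => g y * (σ y - s) := by
        funext y
        by_cases hy : y ∈ E <;> simp [h, hy]
      rw [this, integral_indicator hE]
      have e2 : ∀ y, |g y - c| = g y * σ y - c * σ y := by
        intro y
        simp only [σ]
        split_ifs with hy
        · rw [abs_of_nonneg (by linarith)]; ring
        · rw [abs_of_neg (by linarith)]; ring
      simp_rw [e2, mul_sub]
      rw [integral_sub hgσ (hgE.mul_const s), integral_sub hgσ (hσE.const_mul c),
        integral_mul_const, integral_const_mul, hs, hc]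
      ring
    rw [← e1]
    refine (le_abs_self _).trans (key.trans_eq ?_)
    ring
  · by_cases hy : y ∈ E
    · simp only [h, Set.indicator_of_mem hy]
      have := abs_sub (σ y) s
      linarith [hσ1 y]
    · simp [h, Set.indicator_of_notMem hy]

end AdaptedPartition

/-- Truncation of a real number to the interval `[-N, N]`. -/
def truncate (N s : ℝ) : ℝ := max (-N) (min N s)

theorem abs_truncate_le {N : ℝ} (hN : 0 ≤ N) (s : ℝ) : |truncate N s| ≤ N :=
  abs_le.2 ⟨le_max_left _ _, max_le (by linarith) (min_le_left _ _)⟩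

theorem truncate_of_abs_le {N s : ℝ} (h : |s| ≤ N) : truncate N s = s := by
  rw [truncate, min_eq_right (abs_le.1 h).2, max_eq_right (abs_le.1 h).1]

theorem lipschitzWith_truncate (N : ℝ) : LipschitzWith 1 (truncate N) :=
  (LipschitzWith.id.const_min N).const_max (-N)

theorem IsOneInfAtom.integrable {μ : Measure M} [BorelSpace M] {D : ℝ}
    (hμ : IsDoublingWith μ D) {a : M → ℝ} (ha : IsOneInfAtom μ a) : Integrable a μ := by
  obtain ⟨hm, x, r, -, hoff, hle, -⟩ := ha
  have : IntegrableOn a (ball x r) μ :=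
    Measure.integrableOn_of_bounded (hμ.lt_top x r).ne hm.aestronglyMeasurable
      (ae_restrict_of_ae hle)
  exact (integrableOn_iff_integrable_of_support_subset
    fun y hy => by_contra fun h => hy (hoff y h)).1 this

theorem AdaptedPartition.abs_integral_truncate_symbol_mul_atom_le [BorelSpace M]
    [SigmaCompactSpace M] {μ : Measure M} [IsLocallyFiniteMeasure μ] {C ε D : ℝ} {ι : Type*}
    (P : AdaptedPartition μ C ε ι) (hμ : IsDoublingWith μ D)
    {G : (M → ℝ) →ₗ[ℝ] ℝ} (hG : IsAtomBounded μ G) (hC : 1 ≤ C) {N : ℝ} (hN : 0 ≤ N)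
    {a : M → ℝ} (ha : IsOneInfAtom μ a) :
    |∫ y, truncate N (P.symbol G y) * a y ∂μ| ≤ 4 * C * D ^ 7 := by
  have hai := ha.integrable hμ
  obtain ⟨hm, x, r, hr, hoff, hle, h0⟩ := ha
  have hB := hμ.pos x r hr
  change ∀ᵐ y ∂μ, |a y| ≤ (μ.real (ball x r))⁻¹ at hle
  set u : M → ℝ := fun y => truncate N (P.symbol G y) with hu
  have huc : Continuous u := (lipschitzWith_truncate N).continuous.comp (P.continuous_symbol G)
  have hub : ∀ y, |u y| ≤ N := fun y => abs_truncate_le hN _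
  have hua : Integrable (fun y => u y * a y) μ :=
    hai.bdd_mul (c := N) huc.measurable.aestronglyMeasurable (Eventually.of_forall hub)
  let E : ℕ → Set M := fun n => compactCovering M n ∩ ball x r
  have hEm : ∀ n, MeasurableSet (E n) := fun n =>
    (isCompact_compactCovering M n).measurableSet.inter measurableSet_ball
  have hEmono : Monotone E := fun m n hmn =>
    Set.inter_subset_inter_left _ (compactCovering_subset M hmn)
  have hEU : ⋃ n, E n = ball x r := by
    rw [← Set.iUnion_inter, iUnion_compactCovering, Set.univ_inter]
  have lim1 : Tendsto (fun n => ∫ y in E n, u y * a y ∂μ) atTop (nhds (∫ y, u y * a y ∂μ)) := by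
    have := tendsto_setIntegral_of_monotone hEm hEmono hua.integrableOn
    rwa [hEU, setIntegral_eq_integral_of_forall_compl_eq_zero
      fun y hy => by rw [hoff y hy, mul_zero]] at this
  have lim2 : Tendsto (fun n => ∫ y in E n, a y ∂μ) atTop (nhds 0) := by
    have := tendsto_setIntegral_of_monotone hEm hEmono hai.integrableOn
    rwa [hEU, setIntegral_eq_integral_of_forall_compl_eq_zero hoff, h0] at this
  have lim3 : Tendsto (fun n => 4 * C * D ^ 7 + N * |∫ y in E n, a y ∂μ|) atTop
      (nhds (4 * C * D ^ 7)) := by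
    simpa using (lim2.abs.const_mul N).const_add (4 * C * D ^ 7)
  refine le_of_tendsto_of_tendsto' lim1.abs lim3 fun n => ?_
  obtain ⟨c, hc⟩ := P.exists_setIntegral_abs_symbol_sub_le hμ hG hC
    (isCompact_compactCovering M n) x hr
  change ∫ y in E n, |P.symbol G y - c| ∂μ ≤ _ at hc
  have hgE : IntegrableOn (P.symbol G) (E n) μ :=
    ((P.continuous_symbol G).continuousOn.integrableOn_compact
      (isCompact_compactCovering M n)).mono_set Set.inter_subset_left
  have hEfin : μ (E n) ≠ ⊤ := ((measure_mono Set.inter_subset_right).trans_lt (hμ.lt_top x r)).ne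
  have hdiff : |∫ y in E n, (u y - truncate N c) * a y ∂μ| ≤ 4 * C * D ^ 7 := by
    have hdom : Integrable (fun y => |P.symbol G y - c| * (μ.real (ball x r))⁻¹)
        (μ.restrict (E n)) :=
      (hgE.sub (integrableOn_const hEfin)).abs.mul_const _
    rw [← Real.norm_eq_abs]
    refine (norm_integral_le_of_norm_le hdom ?_).trans ?_
    · filter_upwards [ae_restrict_of_ae hle] with y hy
      rw [Real.norm_eq_abs, abs_mul]
      refine mul_le_mul ?_ hy (abs_nonneg _) (abs_nonneg _)
      have := (lipschitzWith_truncate N).dist_le_mul (P.symbol G y) c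
      simpa [Real.dist_eq] using this
    · rw [integral_mul_const, ← div_eq_mul_inv, div_le_iff₀ hB]
      exact hc
  have hsplit : ∫ y in E n, u y * a y ∂μ =
      (∫ y in E n, (u y - truncate N c) * a y ∂μ) + truncate N c * ∫ y in E n, a y ∂μ := by
    simp_rw [sub_mul]
    rw [integral_sub hua.integrableOn (hai.const_mul _).integrableOn, integral_const_mul]
    ring
  rw [hsplit]
  refine (abs_add_le _ _).trans ?_
  rw [abs_mul]
  gcongr
  exact abs_truncate_le hN c

theorem AdaptedPartition.abs_average_sub_le [BorelSpace M] {μ : Measure M}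
    [IsLocallyFiniteMeasure μ] {C ε D : ℝ} {ι : Type*} (P : AdaptedPartition μ C ε ι)
    (hμ : IsDoublingWith μ D) {f : M → ℝ} (hf : Integrable f μ) {S : Finset ι} {E : Set M}
    (hS : ∀ i, (Function.support (P.fn i) ∩ E).Nonempty → i ∈ S) (hE : ∀ y, y ∉ E → f y = 0)
    {δ : ℝ} (hδ : 0 ≤ δ) (hfδ : ∀ x y, dist x y < 2 * ε → |f x - f y| ≤ δ) (x : M) :
    |P.average f S x - f x| ≤ δ := by
  have hfx : f x = ∑ i ∈ S, f x * P.fn i x := by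
    by_cases hx : x ∈ E
    · rw [← Finset.mul_sum, P.sum_fn_eq_one hS hx, mul_one]
    · simp [hE x hx]
  rw [P.average_apply]
  nth_rw 1 [hfx]
  rw [← Finset.sum_sub_distrib]
  calc |∑ i ∈ S, ((∫ y, P.fn i y * f y ∂μ) / P.weight i * P.fn i x - f x * P.fn i x)|
      ≤ ∑ i ∈ S, |(∫ y, P.fn i y * f y ∂μ) / P.weight i * P.fn i x - f x * P.fn i x| :=
        Finset.abs_sum_le_sum_abs _ _
    _ ≤ ∑ i ∈ S, δ * P.fn i x := by
        refine Finset.sum_le_sum fun i _ => ?_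
        rw [← sub_mul, abs_mul, abs_of_nonneg (P.nonneg i x)]
        by_cases hix : P.fn i x = 0
        · simp [hix]
        refine mul_le_mul_of_nonneg_right ?_ (P.nonneg i x)
        have hw := P.weight_pos hμ i
        rw [div_sub' hw.ne', abs_div, abs_of_pos hw, div_le_iff₀ hw]
        have e : (∫ y, P.fn i y * f y ∂μ) - P.weight i * f x =
            ∫ y, P.fn i y * (f y - f x) ∂μ := by
          simp_rw [mul_sub]
          rw [integral_sub (P.integrable_fn_mul hf i) ((P.integrable_fn i).mul_const _),
            integral_mul_const]
          rfl
        rw [e, AdaptedPartition.weight, ← integral_const_mul, ← Real.norm_eq_abs]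
        refine norm_integral_le_of_norm_le ((P.integrable_fn i).const_mul δ)
          (Eventually.of_forall fun y => ?_)
        rw [Real.norm_eq_abs, abs_mul, abs_of_nonneg (P.nonneg i y), mul_comm]
        by_cases hiy : P.fn i y = 0
        · simp [hiy]
        refine mul_le_mul_of_nonneg_right (hfδ y x ?_) (P.nonneg i y)
        have h1 := P.support_subset i hix
        have h2 := P.support_subset i hiy
        rw [mem_ball] at h1 h2
        have := dist_triangle_right y x (P.center i)
        linarith [P.radius_le i]
    _ = δ * ∑ i ∈ S, P.fn i x := (Finset.mul_sum _ _ _).symm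
    _ ≤ δ := mul_le_of_le_one_right hδ (P.sum_fn_le_one S x)

theorem exists_abs_apply_sub_integral_symbol_mul_le [BorelSpace M] [Nonempty M] {μ : Measure M}
    [IsLocallyFiniteMeasure μ] {D : ℝ} (hμ : IsDoublingWith μ D) {G : (M → ℝ) →ₗ[ℝ] ℝ}
    (hG : IsAtomBounded μ G) {f : M → ℝ} (hf : f ∈ compactlySupportedSubmodule M)
    {δ : ℝ} (hδ : 0 < δ) :
    ∃ ε > 0, ∀ (C : ℝ) (ι : Type _) (P : AdaptedPartition μ C ε ι),
      |G f - ∫ y, P.symbol G y * f y ∂μ| ≤ δ := by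
  have hfi : Integrable f μ := hf.1.integrable_of_hasCompactSupport hf.2
  obtain ⟨o⟩ := ‹Nonempty M›
  obtain ⟨R, hR, hKR⟩ := hf.2.isBounded.subset_ball_lt 0 o
  have hB := hμ.pos o (R + 2) (by linarith)
  have huc := hf.2.uniformContinuous_of_continuous hf.1
  obtain ⟨η, hη, hfη⟩ := Metric.uniformContinuous_iff.1 huc (δ / μ.real (ball o (R + 2)))
    (by positivity)
  refine ⟨min (η / 2) 1, by positivity, fun C ι P => ?_⟩
  have hfin := P.finite_support_inter_nonempty hf.2
  have hS : ∀ i, (Function.support (P.fn i) ∩ tsupport f).Nonempty → i ∈ hfin.toFinset :=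
    fun i hi => hfin.mem_toFinset.2 hi
  have hE : ∀ y, y ∉ tsupport f → f y = 0 := fun y hy => image_eq_zero_of_notMem_tsupport hy
  have hai : Integrable (P.average f hfin.toFinset) μ :=
    (P.average_mem f _).1.integrable_of_hasCompactSupport (P.average_mem f _).2
  have key := hG (P.average f hfin.toFinset - f)
    (Submodule.sub_mem _ (P.average_mem f _) hf) ?_ o (R + 2) (δ / μ.real (ball o (R + 2)))
    (by linarith) ?_ ?_
  · rw [map_sub, P.apply_average G hfi hS hE, abs_sub_comm, div_mul_cancel₀ _ hB.ne'] at key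
    exact key
  · simp only [Pi.sub_apply]
    rw [integral_sub hai hfi, P.integral_average hμ hfi hS hE, sub_self]
  · intro y hy
    have h1 : f y = 0 := hE y fun h => hy (ball_subset_ball (by linarith) (hKR h))
    have h2 : P.average f hfin.toFinset y = 0 := by
      refine P.average_eq_zero fun i hi => ?_
      by_contra hne
      obtain ⟨z, hz, hzK⟩ := hfin.mem_toFinset.1 hi
      have h1 := P.support_subset i hne
      have h2 := P.support_subset i hz
      have h3 := hKR hzK
      rw [mem_ball] at h1 h2 h3 hy
      have := dist_triangle y z o
      have := dist_triangle_right y z (P.center i)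
      have := (P.radius_le i).trans (min_le_right _ _)
      linarith
    simp [h1, h2]
  · intro y
    refine P.abs_average_sub_le hμ hfi hS hE (by positivity) (fun x y hxy => ?_) y
    rw [← Real.dist_eq]
    refine (hfη (hxy.trans_le ?_)).le
    linarith [min_le_left (η / 2) 1]

theorem abs_integral_mul_le_mul_tsum_of_tendsto [BorelSpace M] {μ : Measure M} {u f : M → ℝ}
    {N B : ℝ} (hu : Continuous u) (huN : ∀ y, |u y| ≤ N) (hf : Integrable f μ) {lam : ℕ → ℝ}
    {a : ℕ → M → ℝ} (hai : ∀ k, Integrable (a k) μ) (hB : 0 ≤ B)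
    (hua : ∀ k, |∫ y, u y * a k y ∂μ| ≤ B) (hlam : Summable fun k => |lam k|)
    (hlim : Tendsto (fun n => ∫ x, |f x - ∑ k ∈ Finset.range n, lam k * a k x| ∂μ)
      atTop (nhds 0)) :
    |∫ y, u y * f y ∂μ| ≤ B * ∑' k, |lam k| := by
  have hmul : ∀ {g : M → ℝ}, Integrable g μ → Integrable (fun y => u y * g y) μ := fun hg =>
    hg.bdd_mul (c := N) hu.measurable.aestronglyMeasurable (Eventually.of_forall huN)
  have hlim' := (hlim.const_mul N).const_add (B * ∑' k, |lam k|)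
  rw [mul_zero, add_zero] at hlim'
  refine ge_of_tendsto' hlim' fun n => ?_
  have hsum : Integrable (fun x => ∑ k ∈ Finset.range n, lam k * a k x) μ :=
    integrable_finsetSum _ fun k _ => (hai k).const_mul _
  have e : ∫ y, u y * f y ∂μ = (∑ k ∈ Finset.range n, lam k * ∫ y, u y * a k y ∂μ) +
      ∫ y, u y * (f y - ∑ k ∈ Finset.range n, lam k * a k y) ∂μ := by
    simp_rw [mul_sub]
    rw [integral_sub (hmul hf) (hmul hsum)]
    simp_rw [Finset.mul_sum]
    rw [integral_finsetSum _ fun k _ => hmul ((hai k).const_mul _)]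
    simp_rw [mul_left_comm (u _), integral_const_mul]
    ring
  rw [e]
  refine (abs_add_le _ _).trans (add_le_add ?_ ?_)
  · calc |∑ k ∈ Finset.range n, lam k * ∫ y, u y * a k y ∂μ|
        ≤ ∑ k ∈ Finset.range n, |lam k * ∫ y, u y * a k y ∂μ| := Finset.abs_sum_le_sum_abs _ _
      _ ≤ ∑ k ∈ Finset.range n, B * |lam k| := by
          refine Finset.sum_le_sum fun k _ => ?_
          rw [abs_mul, mul_comm]
          exact mul_le_mul_of_nonneg_right (hua k) (abs_nonneg _)
      _ = B * ∑ k ∈ Finset.range n, |lam k| := (Finset.mul_sum _ _ _).symm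
      _ ≤ B * ∑' k, |lam k| :=
          mul_le_mul_of_nonneg_left (hlam.sum_le_tsum _ fun _ _ => abs_nonneg _) hB
  · rw [← Real.norm_eq_abs, ← integral_const_mul]
    refine norm_integral_le_of_norm_le ((hf.sub hsum).abs.const_mul N)
      (Eventually.of_forall fun y => ?_)
    rw [Real.norm_eq_abs, abs_mul]
    exact mul_le_mul_of_nonneg_right (huN y) (abs_nonneg _)

theorem IsAtomBounded.abs_apply_le_mul_tsum [BorelSpace M] [LocallyCompactSpace M] [Nonempty M]
    {μ : Measure M} {D : ℝ} (hμ : IsDoublingWith μ D) {G : (M → ℝ) →ₗ[ℝ] ℝ}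
    (hG : IsAtomBounded μ G) {f : M → ℝ} (hf : f ∈ compactlySupportedSubmodule M)
    {lam : ℕ → ℝ} {a : ℕ → M → ℝ} (ha : ∀ k, IsOneInfAtom μ (a k))
    (hlam : Summable fun k => |lam k|)
    (hlim : Tendsto (fun n => ∫ x, |f x - ∑ k ∈ Finset.range n, lam k * a k x| ∂μ)
      atTop (nhds 0)) :
    |G f| ≤ 4 * D ^ 16 * ∑' k, |lam k| := by
  have hD := hμ.one_le
  have := hμ.isLocallyFiniteMeasure
  refine le_of_forall_pos_le_add fun δ hδ => ?_
  obtain ⟨ε, hε, happrox⟩ := exists_abs_apply_sub_integral_symbol_mul_le hμ hG hf hδ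
  obtain ⟨v, hv, ⟨P⟩⟩ := exists_adaptedPartition hμ hε
  have := hv.to_subtype
  have := P.sigmaCompactSpace
  have hclose := happrox _ _ P
  obtain ⟨N, hN⟩ := hf.2.exists_bound_of_continuousOn (P.continuous_symbol G).continuousOn
  have hN0 : (0 : ℝ) ≤ max N 0 := le_max_right _ _
  have e : ∫ y, P.symbol G y * f y ∂μ = ∫ y, truncate (max N 0) (P.symbol G y) * f y ∂μ := by
    congr 1
    funext y
    by_cases hy : y ∈ tsupport f
    · rw [truncate_of_abs_le ((hN y hy).trans (le_max_left _ _))]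
    · rw [image_eq_zero_of_notMem_tsupport hy, mul_zero, mul_zero]
  have hmain := abs_integral_mul_le_mul_tsum_of_tendsto (μ := μ)
    (u := fun y => truncate (max N 0) (P.symbol G y)) (B := 4 * D ^ 9 * D ^ 7)
    ((lipschitzWith_truncate _).continuous.comp (P.continuous_symbol G))
    (fun y => abs_truncate_le hN0 _) (hf.1.integrable_of_hasCompactSupport hf.2)
    (fun k => (ha k).integrable hμ) (by positivity)
    (fun k => P.abs_integral_truncate_symbol_mul_atom_le hμ hG (one_le_pow₀ hD) hN0 (ha k))
    hlam hlim
  rw [← e, show 4 * D ^ 9 * D ^ 7 = 4 * D ^ 16 by ring] at hmain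
  have := abs_sub_abs_le_abs_sub (G f) (∫ y, P.symbol G y * f y ∂μ)
  linarith

/-- `h` is a finite combination of continuous compactly supported atoms whose coefficients have
absolute values summing to at most `s`. -/
def HasFiniteAtomicBound (μ : Measure M) (h : M → ℝ) (s : ℝ) : Prop :=
  ∃ (N : ℕ) (c : ℕ → ℝ) (b : ℕ → M → ℝ), (∀ j, j < N → IsContCptAtom μ (b j)) ∧
    (∀ x, h x = ∑ j ∈ Finset.range N, c j * b j x) ∧ ∑ j ∈ Finset.range N, |c j| ≤ s

namespace HasFiniteAtomicBound

variable {μ : Measure M} {h h' : M → ℝ} {s s' : ℝ}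

theorem nonneg (H : HasFiniteAtomicBound μ h s) : 0 ≤ s := by
  obtain ⟨N, c, b, -, -, hs⟩ := H
  exact (Finset.sum_nonneg fun _ _ => abs_nonneg _).trans hs

theorem add (H : HasFiniteAtomicBound μ h s) (H' : HasFiniteAtomicBound μ h' s') :
    HasFiniteAtomicBound μ (h + h') (s + s') := by
  obtain ⟨N, c, b, hb, he, hs⟩ := H
  obtain ⟨N', c', b', hb', he', hs'⟩ := H'
  have hlt : ∀ j ∈ Finset.range N, j < N := fun j => Finset.mem_range.1
  have hge : ∀ j, ¬ N + j < N := fun j => by omega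
  refine ⟨N + N', fun j => if j < N then c j else c' (j - N),
    fun j => if j < N then b j else b' (j - N), fun j hj => ?_, fun x => ?_, ?_⟩
  · by_cases hjN : j < N
    · simpa only [if_pos hjN] using hb j hjN
    · simpa only [if_neg hjN] using hb' (j - N) (by omega)
  · rw [Pi.add_apply, he, he', Finset.sum_range_add]
    congr 1
    · exact Finset.sum_congr rfl fun j hj => by simp only [if_pos (hlt j hj)]
    · exact Finset.sum_congr rfl fun j _ => by simp only [if_neg (hge j), Nat.add_sub_cancel_left]
  · rw [Finset.sum_range_add]
    refine add_le_add (le_of_eq_of_le ?_ hs) (le_of_eq_of_le ?_ hs')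
    · exact Finset.sum_congr rfl fun j hj => by simp only [if_pos (hlt j hj)]
    · exact Finset.sum_congr rfl fun j _ => by simp only [if_neg (hge j), Nat.add_sub_cancel_left]

theorem smul (H : HasFiniteAtomicBound μ h s) (t : ℝ) :
    HasFiniteAtomicBound μ (t • h) (|t| * s) := by
  obtain ⟨N, c, b, hb, he, hs⟩ := H
  refine ⟨N, fun j => t * c j, b, hb, fun x => ?_, ?_⟩
  · simp only [Pi.smul_apply, he, smul_eq_mul, Finset.mul_sum, mul_assoc]
  · simp only [abs_mul, ← Finset.mul_sum]
    exact mul_le_mul_of_nonneg_left hs (abs_nonneg t)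

theorem zero (μ : Measure M) : HasFiniteAtomicBound μ 0 0 :=
  ⟨0, 0, 0, by simp, by simp, by simp⟩

theorem of_support_subset_ball [BorelSpace M] {D : ℝ} (hμ : IsDoublingWith μ D)
    (hh : h ∈ compactlySupportedSubmodule M) (h0 : ∫ y, h y ∂μ = 0) {x : M} {r A : ℝ}
    (hr : 0 < r) (hoff : ∀ y, y ∉ ball x r → h y = 0) (hA : ∀ y, |h y| ≤ A) :
    HasFiniteAtomicBound μ h (A * μ.real (ball x r)) := by
  have hB := hμ.pos x r hr
  rcases ((abs_nonneg _).trans (hA x)).eq_or_lt with hA0 | hA0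
  · have : h = 0 := funext fun y => abs_nonpos_iff.1 (hA0 ▸ hA y)
    rw [this, ← hA0, zero_mul]
    exact zero μ
  · refine ⟨1, fun _ => A * μ.real (ball x r), fun _ y => (A * μ.real (ball x r))⁻¹ * h y,
      fun _ _ => ⟨⟨hh.1.measurable.const_mul _, x, r, hr,
        fun y hy => by simp only [hoff y hy, mul_zero],
        Eventually.of_forall fun y => ?_, ?_⟩, continuous_const.mul hh.1, hh.2.mul_left⟩,
      fun y => ?_, ?_⟩
    · change _ ≤ (μ.real (ball x r))⁻¹
      rw [abs_mul, abs_of_pos (by positivity), mul_inv, mul_right_comm]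
      refine mul_le_of_le_one_left (by positivity) ?_
      rw [inv_mul_le_one₀ hA0]
      exact hA y
    · rw [integral_const_mul, h0, mul_zero]
    · rw [Finset.sum_range_one, mul_inv_cancel_left₀ (by positivity)]
    · rw [Finset.sum_range_one, abs_of_pos (by positivity)]

theorem mem (H : HasFiniteAtomicBound μ h s) : h ∈ compactlySupportedSubmodule M := by
  obtain ⟨N, c, b, hb, he, -⟩ := H
  have : h = ∑ j ∈ Finset.range N, c j • b j := by
    funext x
    simp [he, Finset.sum_apply]
  rw [this]
  exact Submodule.sum_mem _ fun j hj =>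
    Submodule.smul_mem _ _ (hb j (Finset.mem_range.1 hj)).2

end HasFiniteAtomicBound

/-- The infimum of the sums of coefficients over all finite decompositions into continuous
compactly supported atoms. -/
noncomputable def finiteAtomicNorm (μ : Measure M) (h : M → ℝ) : ℝ :=
  sInf {s | HasFiniteAtomicBound μ h s}

section FiniteAtomicNorm

variable {μ : Measure M} {h h' : M → ℝ} {s : ℝ}

theorem HasFiniteAtomicBound.finiteAtomicNorm_le (H : HasFiniteAtomicBound μ h s) :
    finiteAtomicNorm μ h ≤ s :=
  csInf_le ⟨0, fun _ H => H.nonneg⟩ H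

theorem finiteAtomicNorm_nonneg (μ : Measure M) (h : M → ℝ) : 0 ≤ finiteAtomicNorm μ h :=
  Real.sInf_nonneg fun _ H => H.nonneg

theorem finiteAtomicNorm_add_le (hh : ∃ s, HasFiniteAtomicBound μ h s)
    (hh' : ∃ s, HasFiniteAtomicBound μ h' s) :
    finiteAtomicNorm μ (h + h') ≤ finiteAtomicNorm μ h + finiteAtomicNorm μ h' := by
  refine le_of_forall_pos_le_add fun δ hδ => ?_
  obtain ⟨s, hs, hlt⟩ := exists_lt_of_csInf_lt hh
    (show finiteAtomicNorm μ h < finiteAtomicNorm μ h + δ / 2 by linarith)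
  obtain ⟨s', hs', hlt'⟩ := exists_lt_of_csInf_lt hh'
    (show finiteAtomicNorm μ h' < finiteAtomicNorm μ h' + δ / 2 by linarith)
  have := (HasFiniteAtomicBound.add hs hs').finiteAtomicNorm_le
  linarith

theorem finiteAtomicNorm_smul_le (hh : ∃ s, HasFiniteAtomicBound μ h s) {t : ℝ} (ht : 0 < t) :
    finiteAtomicNorm μ (t • h) ≤ t * finiteAtomicNorm μ h := by
  rw [mul_comm, ← div_le_iff₀ ht]
  refine le_csInf hh fun s hs => ?_
  rw [div_le_iff₀ ht, mul_comm]
  have := (HasFiniteAtomicBound.smul hs t).finiteAtomicNorm_le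
  rwa [abs_of_pos ht] at this

theorem finiteAtomicNorm_smul (hh : ∃ s, HasFiniteAtomicBound μ h s) {t : ℝ} (ht : 0 < t) :
    finiteAtomicNorm μ (t • h) = t * finiteAtomicNorm μ h := by
  refine (finiteAtomicNorm_smul_le hh ht).antisymm ?_
  have hth : ∃ s, HasFiniteAtomicBound μ (t • h) s := hh.imp' _ fun s hs => hs.smul t
  have := finiteAtomicNorm_smul_le hth (inv_pos.2 ht)
  rwa [inv_smul_smul₀ ht.ne', le_inv_mul_iff₀ ht] at this

end FiniteAtomicNorm

/-- The finite combinations of continuous compactly supported atoms. -/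
def finiteAtomicSubmodule (μ : Measure M) : Submodule ℝ (M → ℝ) where
  carrier := {h | ∃ s, HasFiniteAtomicBound μ h s}
  zero_mem' := ⟨0, .zero μ⟩
  add_mem' := fun ⟨_, hs⟩ ⟨_, hs'⟩ => ⟨_, hs.add hs'⟩
  smul_mem' := fun t _ ⟨_, hs⟩ => ⟨_, hs.smul t⟩

theorem exists_isAtomBounded_apply_eq [BorelSpace M] {μ : Measure M} {D : ℝ}
    (hμ : IsDoublingWith μ D) {f : M → ℝ} (hf : f ∈ finiteAtomicSubmodule μ) (hf0 : f ≠ 0) :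
    ∃ G : (M → ℝ) →ₗ[ℝ] ℝ, IsAtomBounded μ G ∧ G f = finiteAtomicNorm μ f := by
  let Z := finiteAtomicSubmodule μ
  let f' : Z := ⟨f, hf⟩
  have hf' : f' ≠ 0 := fun h => hf0 (congrArg Subtype.val h)
  obtain ⟨F, hF, hFle⟩ := exists_extension_of_le_sublinear
    (LinearPMap.mkSpanSingleton (σ := RingHom.id ℝ) f' (finiteAtomicNorm μ f) hf')
    (fun h : Z => finiteAtomicNorm μ (h : M → ℝ))
    (fun t ht h => finiteAtomicNorm_smul h.2 ht)
    (fun h h' => finiteAtomicNorm_add_le h.2 h'.2) (by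
      rintro ⟨y, hy⟩
      obtain ⟨t, rfl⟩ := Submodule.mem_span_singleton.1 hy
      rw [LinearPMap.mkSpanSingleton'_apply]
      change t * finiteAtomicNorm μ f ≤ finiteAtomicNorm μ (t • f)
      rcases le_or_gt t 0 with ht | ht
      · exact (mul_nonpos_of_nonpos_of_nonneg ht (finiteAtomicNorm_nonneg μ f)).trans
          (finiteAtomicNorm_nonneg μ _)
      · exact (finiteAtomicNorm_smul hf ht).ge)
  obtain ⟨G, hG⟩ := F.exists_extend
  have hGF : ∀ h : Z, G (h : M → ℝ) = F h := fun h => DFunLike.congr_fun hG h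
  refine ⟨G, fun h hh h0 x r A hr hoff hA => ?_, ?_⟩
  · have H := HasFiniteAtomicBound.of_support_subset_ball hμ hh h0 hr hoff hA
    have H' := H.smul (-1)
    rw [abs_neg, abs_one, one_mul] at H'
    refine abs_le'.2 ⟨?_, ?_⟩
    · exact (hGF ⟨h, _, H⟩).trans_le ((hFle _).trans H.finiteAtomicNorm_le)
    · rw [← map_neg, ← neg_one_smul ℝ h]
      exact (hGF ⟨_, _, H'⟩).trans_le ((hFle _).trans H'.finiteAtomicNorm_le)
  · rw [show G f = F f' from hGF f']
    have := hF ⟨f', Submodule.mem_span_singleton_self f'⟩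
    rw [this]
    exact LinearPMap.mkSpanSingleton_apply ℝ ℝ hf' _

end Doubling

/-- Equivalence of the `H¹` and `F^C_c` norms on finite linear combinations
of continuous compactly supported `(1,∞)`-atoms: there is a constant `C` such that any
countable atomic decomposition `f = Σ λ_k a_k` (in `L¹(μ)`) of such an `f` can be replaced
by a finite decomposition into continuous compactly supported atoms with
`Σ |c_j| ≤ C · Σ |λ_k|`. -/
theorem stmt9 {M : Type*} [MetricSpace M] [MeasurableSpace M] [BorelSpace M]
    [LocallyCompactSpace M]
    (μ : Measure M)
    (hμ : ∀ (x : M) (r : ℝ), 0 < r → 0 < μ (ball x r) ∧ μ (ball x r) < ⊤)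
    (hinf : μ Set.univ = ⊤)
    (D : ℝ) (hD : 1 ≤ D)
    (hdoub : ∀ (x : M) (r : ℝ), 0 < r →
      μ (ball x (2 * r)) ≤ ENNReal.ofReal D * μ (ball x r)) :
    ∃ C : ℝ, 0 < C ∧ ∀ f : M → ℝ,
      (∃ (N : ℕ) (c : ℕ → ℝ) (b : ℕ → M → ℝ),
        (∀ j, j < N → IsContCptAtom μ (b j)) ∧
        ∀ x, f x = ∑ j ∈ Finset.range N, c j * b j x) →
      ∀ (lam : ℕ → ℝ) (a : ℕ → M → ℝ),
        (∀ k, IsOneInfAtom μ (a k)) →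
        Summable (fun k => |lam k|) →
        Tendsto (fun n => ∫ x, |f x - ∑ k ∈ Finset.range n, lam k * a k x| ∂μ)
          atTop (nhds 0) →
        ∃ (N : ℕ) (c : ℕ → ℝ) (b : ℕ → M → ℝ),
          (∀ j, j < N → IsContCptAtom μ (b j)) ∧
          (∀ x, f x = ∑ j ∈ Finset.range N, c j * b j x) ∧
          ∑ j ∈ Finset.range N, |c j| ≤ C * ∑' k, |lam k| := by
  have hμD : IsDoublingWith μ D :=
    { one_le := hD
      pos := fun x r hr => ENNReal.toReal_pos (hμ x r hr).1.ne' (hμ x r hr).2.ne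
      lt_top := fun x r => by
        rcases le_or_gt r 0 with hr | hr
        · simp [ball_eq_empty.2 hr]
        · exact (hμ x r hr).2
      two_mul := fun x r hr => by
        have := ENNReal.toReal_mono (ENNReal.mul_ne_top ENNReal.ofReal_ne_top (hμ x r hr).2.ne)
          (hdoub x r hr)
        rwa [ENNReal.toReal_mul, ENNReal.toReal_ofReal (by linarith)] at this }
  have hne : Nonempty M := by
    by_contra h
    rw [not_nonempty_iff] at h
    simp [Set.univ_eq_empty_iff.2 h] at hinf
  have := hμD.isLocallyFiniteMeasure
  have hopen : μ.IsOpenPosMeasure := by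
    refine ⟨fun U hU ⟨x, hx⟩ h0 => ?_⟩
    obtain ⟨r, hr, hsub⟩ := Metric.isOpen_iff.1 hU x hx
    exact (hμ x r hr).1.ne' (measure_mono_null hsub h0)
  refine ⟨8 * D ^ 16, by positivity, fun f ⟨N, c, b, hb, hf⟩ lam a ha hlam hlim => ?_⟩
  have hfB : HasFiniteAtomicBound μ f (∑ j ∈ Finset.range N, |c j|) := ⟨N, c, b, hb, hf, le_rfl⟩
  change HasFiniteAtomicBound μ f _
  rcases eq_or_ne f 0 with rfl | hf0
  · refine ⟨0, 0, 0, by simp, by simp, ?_⟩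
    rw [Finset.sum_range_zero]
    exact mul_nonneg (by positivity) (tsum_nonneg fun _ => abs_nonneg _)
  obtain ⟨G, hG, hGf⟩ := exists_isAtomBounded_apply_eq hμD ⟨_, hfB⟩ hf0
  have hle := (le_abs_self _).trans (hG.abs_apply_le_mul_tsum hμD hfB.mem ha hlam hlim)
  rw [hGf] at hle
  have hpos : 0 < ∑' k, |lam k| := by
    refine (tsum_nonneg fun _ => abs_nonneg _).lt_of_ne fun h0 => hf0 ?_
    have hzero : ∀ k, lam k = 0 := fun k =>
      abs_nonpos_iff.1 (h0 ▸ hlam.le_tsum k fun _ _ => abs_nonneg _)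
    simp only [hzero, zero_mul, Finset.sum_const_zero, sub_zero] at hlim
    have hint := tendsto_nhds_unique tendsto_const_nhds hlim
    rw [integral_eq_zero_iff_of_nonneg (fun _ => abs_nonneg _)
      (hfB.mem.1.integrable_of_hasCompactSupport hfB.mem.2).abs] at hint
    have := (hfB.mem.1.abs.ae_eq_iff_eq μ continuous_zero).1 hint
    exact funext fun x => abs_eq_zero.1 (congrFun this x)
  have hD16 : 0 < D ^ 16 * ∑' k, |lam k| := by positivity
  obtain ⟨s, ⟨N', c', b', hb', hf', hs'⟩, hlt⟩ := exists_lt_of_csInf_lt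
    (show {s | HasFiniteAtomicBound μ f s}.Nonempty from ⟨_, hfB⟩)
    (show finiteAtomicNorm μ f < 8 * D ^ 16 * ∑' k, |lam k| by linarith)
  exact ⟨N', c', b', hb', hf', hs'.trans hlt.le⟩
end
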